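/- arXiv:2510.24882 — 7 statements merged into one kernel-verified Lean document; each statement's English description precedes it below -/
import Mathlib

section
/- Let p be a prime and m a positive integer with p ∤ m. Then the number of orbits of the Φ_p state map on (ℤ/mℤ)^(p-1) equals (m^(p-1) − 1)/p + 1; specifically, the zero vector is the unique fixed point and there are exactly (m^(p-1) − 1)/p orbits of length p. -/
/-- The orbit of a state `v` under a map `f`: all forward iterates of `v`. -/
def orbitOf {α : Type*} (f : α → α) (v : α) : Set α := {w | ∃ k : ℕ, f^[k] v = w}

/-- The set of orbits of a map `f`. -/
def orbitsOf {α : Type*} (f : α → α) : Set (Set α) := Set.range (orbitOf f)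

/-- The Φ_p state map on `(ℤ/mℤ)^(p-1)`: shift left and append
`-(v_0 + ⋯ + v_{p-2})`, the state-transition map of the recurrence
`a_n = -(a_{n-1} + ⋯ + a_{n-p+1})` with characteristic polynomial `Φ_p`. -/
def phiPStep (p m : ℕ) (v : Fin (p - 1) → ZMod m) : Fin (p - 1) → ZMod m :=
  fun i => if h : (i : ℕ) + 1 < p - 1 then v ⟨(i : ℕ) + 1, h⟩ else -(∑ j, v j)

/-- Two points are in the same orbit iff their orbits agree, when `f^[p] = id`. -/
lemma orbitOf_eq_iff_aux {α : Type*} (f : α → α) (p : ℕ) (hp : 0 < p) (hf : ∀ v, f^[p] v = v)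
    (v w : α) : orbitOf f w = orbitOf f v ↔ w ∈ orbitOf f v := by
  constructor
  · intro h
    rw [← h]
    exact ⟨0, rfl⟩
  · rintro ⟨k, rfl⟩
    have hper : ∀ n x, f^[n * p] x = x := by
      intro n x
      have h : Function.IsPeriodicPt f p x := hf x
      exact h.const_mul n
    ext x
    constructor
    · rintro ⟨j, rfl⟩
      exact ⟨j + k, Function.iterate_add_apply f j k v⟩
    · rintro ⟨j, rfl⟩
      refine ⟨j + (k * p - k), ?_⟩
      have hk : k ≤ k * p := Nat.le_mul_of_pos_right k hp
      rw [← Function.iterate_add_apply, add_assoc, Nat.sub_add_cancel hk,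
        Function.iterate_add_apply, hper]

lemma orbitOf_ncard_aux {α : Type*} (f : α → α) (p : ℕ) (hp : p.Prime) (hf : ∀ v, f^[p] v = v)
    (v : α) (hv : f v ≠ v) : (orbitOf f v).ncard = p := by
  have hmin : Function.minimalPeriod f v = p := by
    have h : Function.IsPeriodicPt f p v := hf v
    rcases (Nat.dvd_prime hp).1 h.minimalPeriod_dvd with h1 | h1
    · exact absurd (Function.minimalPeriod_eq_one_iff_isFixedPt.1 h1) hv
    · exact h1
  have himg : orbitOf f v = (fun k => f^[k] v) '' Set.Iio p := by
    ext x
    constructor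
    · rintro ⟨k, rfl⟩
      refine ⟨k % p, Nat.mod_lt _ hp.pos, ?_⟩
      have h : Function.IsPeriodicPt f p v := hf v
      exact h.iterate_mod_apply k
    · rintro ⟨k, -, rfl⟩
      exact ⟨k, rfl⟩
  have hinj : Set.InjOn (fun k => f^[k] v) (Set.Iio p) := by
    have := Function.iterate_injOn_Iio_minimalPeriod (f := f) (x := v)
    rwa [hmin] at this
  rw [himg, hinj.ncard_image, ← Finset.coe_Iio, Set.ncard_coe_finset, Nat.card_Iio]

lemma orbit_count_aux {α : Type*} [Finite α] (f : α → α) (p : ℕ) (hp : p.Prime)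
    (hf : ∀ v, f^[p] v = v) (a : α) (ha : ∀ v, f v = v ↔ v = a) :
    (orbitsOf f).ncard = (Nat.card α - 1) / p + 1 ∧
    {O ∈ orbitsOf f | O.ncard = p}.ncard = (Nat.card α - 1) / p := by
  classical
  have := Fintype.ofFinite α
  have horba : orbitOf f a = {a} := by
    ext x
    constructor
    · rintro ⟨k, rfl⟩
      exact Function.iterate_fixed ((ha a).2 rfl) k
    · rintro rfl
      exact ⟨0, rfl⟩
  have hfin : {O ∈ orbitsOf f | O.ncard = p}.Finite := Set.toFinite _
  have hnot : ({a} : Set α) ∉ {O ∈ orbitsOf f | O.ncard = p} := by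
    rintro ⟨-, h⟩
    rw [Set.ncard_singleton] at h
    exact hp.one_lt.ne h
  have hsplit : orbitsOf f = insert {a} {O ∈ orbitsOf f | O.ncard = p} := by
    ext O
    constructor
    · rintro ⟨v, rfl⟩
      by_cases hv : f v = v
      · left
        rw [(ha v).1 hv, horba]
      · right
        exact ⟨⟨v, rfl⟩, orbitOf_ncard_aux f p hp hf v hv⟩
    · rintro (rfl | h)
      · exact ⟨a, horba⟩
      · exact h.1
  set T : Set (Set α) := {O ∈ orbitsOf f | O.ncard = p} with hT
  have hcard : Nat.card α = p * T.ncard + 1 := by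
    have h1 := Finset.card_eq_sum_card_fiberwise (f := orbitOf f) (s := Finset.univ.erase a)
      (t := hfin.toFinset) (by
        intro v hv
        have hv' : v ≠ a := by simpa using hv
        have : orbitOf f v ∈ T :=
          ⟨⟨v, rfl⟩, orbitOf_ncard_aux f p hp hf v (fun h => hv' ((ha v).1 h))⟩
        exact hfin.mem_toFinset.2 this)
    have h2 : ∀ O ∈ hfin.toFinset,
        ((Finset.univ.erase a).filter (fun v => orbitOf f v = O)).card = p := by
      intro O hO
      have hO' : O ∈ T := hfin.mem_toFinset.1 hO
      obtain ⟨⟨v, rfl⟩, hc⟩ := hO'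
      rw [← hc, ← Set.ncard_coe_finset]
      congr 1
      ext w
      simp only [Finset.coe_filter, Finset.mem_erase, Finset.mem_univ, and_true, Set.mem_ofPred_eq]
      rw [orbitOf_eq_iff_aux f p hp.pos hf]
      constructor
      · exact fun h => h.2
      · intro h
        refine ⟨?_, h⟩
        rintro rfl
        have h3 := (orbitOf_eq_iff_aux f p hp.pos hf v w).2 h
        rw [← h3, horba, Set.ncard_singleton] at hc
        exact hp.one_lt.ne hc
    rw [Finset.sum_congr rfl h2, Finset.sum_const, smul_eq_mul,
      ← Set.ncard_eq_toFinset_card T hfin, Finset.card_erase_of_mem (Finset.mem_univ a),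
      Finset.card_univ, ← Nat.card_eq_fintype_card] at h1
    have : 0 < Nat.card α := by
      have : Nonempty α := ⟨a⟩
      exact Nat.card_pos
    rw [mul_comm]
    omega
  have hN : (Nat.card α - 1) / p = T.ncard := by
    rw [hcard, Nat.add_sub_cancel, Nat.mul_div_cancel_left _ hp.pos]
  refine ⟨?_, hN.symm⟩
  rw [hsplit, Set.ncard_insert_of_notMem hnot hfin, hN]

/-- The `p`-periodic extension of a state. -/
def phiPExt (p m : ℕ) (v : Fin (p - 1) → ZMod m) (n : ℕ) : ZMod m :=
  if h : n % p < p - 1 then v ⟨n % p, h⟩ else -(∑ j, v j)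

lemma phiPStep_sum_aux (q m : ℕ) (v : Fin (q + 2 - 1) → ZMod m) :
    -(∑ j, phiPStep (q + 2) m v j) = v ⟨0, by omega⟩ := by
  change -(∑ j : Fin (q + 1), phiPStep (q + 2) m v j) = _
  have h1 : (∑ j, v j) = v ⟨0, by omega⟩ + ∑ j : Fin q, v ⟨j + 1, by omega⟩ :=
    Fin.sum_univ_succ (n := q) v
  rw [Fin.sum_univ_castSucc]
  have h2 : ∀ j : Fin q, phiPStep (q + 2) m v (Fin.castSucc j) = v ⟨j + 1, by omega⟩ := by
    intro j
    have : (j : ℕ) + 1 < q + 2 - 1 := by omega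
    simp [phiPStep]
  have h3 : phiPStep (q + 2) m v (Fin.last q) = -(∑ j, v j) := by
    simp [phiPStep]
  rw [Finset.sum_congr rfl (fun j _ => h2 j), h3, h1]
  ring

lemma phiPExt_step (q m : ℕ) (v : Fin (q + 2 - 1) → ZMod m) (n : ℕ) :
    phiPExt (q + 2) m (phiPStep (q + 2) m v) n = phiPExt (q + 2) m v (n + 1) := by
  have hlt : n % (q + 2) < q + 2 := Nat.mod_lt _ (by omega)
  by_cases h : n % (q + 2) = q + 1
  · have h' : (n + 1) % (q + 2) = 0 := by
      rw [Nat.add_mod, h, Nat.mod_eq_of_lt (show 1 < q + 2 by omega), Nat.mod_self]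
    unfold phiPExt
    rw [dif_neg (by omega), dif_pos (by omega), phiPStep_sum_aux]
    simp only [h']
  · have h' : (n + 1) % (q + 2) = n % (q + 2) + 1 := by
      rw [Nat.add_mod, Nat.mod_eq_of_lt (show 1 < q + 2 by omega), Nat.mod_eq_of_lt (by omega)]
    unfold phiPExt
    rw [dif_pos (by omega)]
    simp only [h', phiPStep]

lemma phiPExt_iterate (q m : ℕ) (k : ℕ) : ∀ (v : Fin (q + 2 - 1) → ZMod m) (n : ℕ),
    phiPExt (q + 2) m ((phiPStep (q + 2) m)^[k] v) n = phiPExt (q + 2) m v (n + k) := by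
  induction k with
  | zero => intro v n; rfl
  | succ k ih =>
    intro v n
    rw [Function.iterate_succ_apply, ih, phiPExt_step]
    rfl

lemma phiPExt_apply (q m : ℕ) (v : Fin (q + 2 - 1) → ZMod m) (i : Fin (q + 2 - 1)) :
    phiPExt (q + 2) m v i = v i := by
  have hi := i.2
  have h : (i : ℕ) % (q + 2) = i := Nat.mod_eq_of_lt (by omega)
  unfold phiPExt
  rw [dif_pos (by omega)]
  simp only [h]

lemma phiPStep_iterate_p (q m : ℕ) (v : Fin (q + 2 - 1) → ZMod m) :
    (phiPStep (q + 2) m)^[q + 2] v = v := by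
  ext i
  rw [← phiPExt_apply q m ((phiPStep (q + 2) m)^[q + 2] v) i, phiPExt_iterate, ← phiPExt_apply q m v i]
  unfold phiPExt
  simp only [Nat.add_mod_right]

lemma phiPStep_fixed (q m : ℕ) (hq : (q + 2).Coprime m) (v : Fin (q + 2 - 1) → ZMod m) :
    phiPStep (q + 2) m v = v ↔ v = 0 := by
  constructor
  · intro h
    have hc : ∀ n, phiPExt (q + 2) m v n = v ⟨0, by omega⟩ := by
      intro n
      induction n with
      | zero => exact phiPExt_apply q m v ⟨0, by omega⟩
      | succ n ih => rw [← phiPExt_step, h, ih]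
    have hv : ∀ i, v i = v ⟨0, by omega⟩ := fun i => by rw [← phiPExt_apply q m v i, hc]
    have hs := phiPStep_sum_aux q m v
    rw [h, Finset.sum_congr rfl (fun i _ => hv i), Finset.sum_const, Finset.card_univ,
      Fintype.card_fin, nsmul_eq_mul] at hs
    have hz : ((q + 2 : ℕ) : ZMod m) * v ⟨0, by omega⟩ = 0 := by
      have e : ((q + 2 - 1 : ℕ) : ZMod m) = (q : ZMod m) + 1 := Nat.cast_succ q
      rw [e] at hs
      push_cast
      linear_combination -hs
    have hu : IsUnit ((q + 2 : ℕ) : ZMod m) := (ZMod.isUnit_iff_coprime _ _).2 hq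
    have h0 := (hu.mul_right_eq_zero).1 hz
    ext i
    rw [hv i, h0]
    rfl
  · rintro rfl
    ext i
    simp [phiPStep]

/-- for a prime `p` and `p ∤ m`, the number of orbits of the Φ_p
state map is `(m^(p-1) - 1)/p + 1`; the zero vector is the unique fixed point
and there are exactly `(m^(p-1) - 1)/p` orbits of length `p`. -/
theorem phiP_orbit_count_of_not_dvd (p m : ℕ) (hp : p.Prime) (hm : 0 < m) (hpm : ¬ p ∣ m) :
    (orbitsOf (phiPStep p m)).ncard = (m ^ (p - 1) - 1) / p + 1 ∧
    {v : Fin (p - 1) → ZMod m | phiPStep p m v = v} = {0} ∧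
    {O ∈ orbitsOf (phiPStep p m) | O.ncard = p}.ncard = (m ^ (p - 1) - 1) / p := by
  obtain ⟨q, rfl⟩ : ∃ q, p = q + 2 := ⟨p - 2, by have := hp.two_le; omega⟩
  have : NeZero m := ⟨hm.ne'⟩
  have hq : (q + 2).Coprime m := (Nat.Prime.coprime_iff_not_dvd hp).2 hpm
  have hcard : Nat.card (Fin (q + 2 - 1) → ZMod m) = m ^ (q + 2 - 1) := by
    simp
  have key := orbit_count_aux (phiPStep (q + 2) m) (q + 2) hp (phiPStep_iterate_p q m) 0
    (phiPStep_fixed q m hq)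
  rw [hcard] at key
  refine ⟨key.1, ?_, key.2⟩
  ext v
  exact phiPStep_fixed q m hq v
end

section
/- Let p be an odd prime and m a positive integer with p ∣ m and m odd. Then the number of orbits of the Φ_{2p} state map on (ℤ/mℤ)^(p-1) equals (m^(p-1) − p)/(2p) + 1 + (p−1)/2. -/
/-- The Φ_{2p} state map on `(ℤ/mℤ)^(p-1)`: shift left and append
`∑_{k=0}^{p-2} (-1)^(k+1) v_k`, the state-transition map of the recurrence
`a_n = a_{n-1} - a_{n-2} + ⋯ + a_{n-(p-1)}` with characteristic polynomial `Φ_{2p}`. -/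
def phi2pStep (p m : ℕ) (v : Fin (p - 1) → ZMod m) : Fin (p - 1) → ZMod m :=
  fun i => if h : (i : ℕ) + 1 < p - 1 then v ⟨(i : ℕ) + 1, h⟩
           else ∑ k : Fin (p - 1), (-1 : ZMod m) ^ ((k : ℕ) + 1) * v k

namespace Phi2p

variable {p m : ℕ}

lemma iter_coord (h1 : 0 < p - 1) (v : Fin (p - 1) → ZMod m) (i : ℕ) :
    ∀ (n : ℕ) (hi : i < p - 1),
      ((phi2pStep p m)^[n] v) ⟨i, hi⟩ = ((phi2pStep p m)^[n + i] v) ⟨0, h1⟩ := by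
  induction i with
  | zero => intro n hi; rfl
  | succ i ih =>
    intro n hi
    have := ih (n + 1) (by omega)
    rw [Function.iterate_succ_apply'] at this
    rw [show n + (i + 1) = n + 1 + i by ring, ← this]
    simp [phi2pStep, hi]

lemma iter_last (h1 : 0 < p - 1) (v : Fin (p - 1) → ZMod m) (n : ℕ) :
    ((phi2pStep p m)^[n + (p - 1)] v) ⟨0, h1⟩ =
      ∑ k ∈ Finset.range (p - 1),
        (-1 : ZMod m) ^ (k + 1) * ((phi2pStep p m)^[n + k] v) ⟨0, h1⟩ := by
  have h := iter_coord h1 v (p - 2) (n + 1) (by omega)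
  rw [show n + 1 + (p - 2) = n + (p - 1) by omega] at h
  rw [← h, Function.iterate_succ_apply', Finset.sum_range]
  rw [phi2pStep, dif_neg (by simp; omega)]
  refine Finset.sum_congr rfl fun k _ => ?_
  rw [← iter_coord h1 v k n k.2]

lemma alt_tele (a : ℕ → ZMod m) (n : ℕ) :
    ∑ k ∈ Finset.range n, (-1 : ZMod m) ^ k * a k
      + ∑ k ∈ Finset.range n, (-1 : ZMod m) ^ k * a (k + 1) = a 0 - (-1) ^ n * a n := by
  induction n with
  | zero => simp
  | succ n ih =>
    rw [Finset.sum_range_succ, Finset.sum_range_succ]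
    linear_combination ih

lemma iter_p (hp2 : 2 < p) (hpodd : Odd p) (v : Fin (p - 1) → ZMod m) :
    (phi2pStep p m)^[p] v = -v := by
  have h1 : 0 < p - 1 := by omega
  have key : ∀ n, ∑ k ∈ Finset.range p,
      (-1 : ZMod m) ^ k * ((phi2pStep p m)^[n + k] v) ⟨0, h1⟩ = 0 := by
    intro n
    have h := iter_last h1 v n
    obtain ⟨t, rfl⟩ := hpodd
    simp only [Nat.add_sub_cancel] at h ⊢
    rw [Finset.sum_range_succ]
    erw [h]
    simp only [pow_mul, pow_succ, Finset.sum_neg_distrib, mul_neg, mul_one, neg_mul]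
    simp
  funext ⟨i, hi⟩
  have t := alt_tele (fun k => ((phi2pStep p m)^[i + k] v) ⟨0, h1⟩) p
  have k0 := key i
  have k1 := key (i + 1)
  have e3 : ∀ k, i + (k + 1) = i + 1 + k := fun k => by ring
  simp_rw [fun k => congrArg (fun n => ((phi2pStep p m)^[n] v) ⟨0, h1⟩) (e3 k)] at t
  simp only [hpodd.neg_one_pow] at t
  rw [k0, k1] at t
  have e1 := iter_coord h1 v i p hi
  have e2 := iter_coord h1 v i 0 hi
  rw [e1, Pi.neg_apply, show v ⟨i, hi⟩ = _ from e2, zero_add, add_comm p i]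
  simp only [add_zero] at t
  linear_combination -t

lemma iter_two_p (hp2 : 2 < p) (hpodd : Odd p) (v : Fin (p - 1) → ZMod m) :
    (phi2pStep p m)^[2 * p] v = v := by
  rw [two_mul, Function.iterate_add_apply, iter_p hp2 hpodd, iter_p hp2 hpodd, neg_neg]

lemma step_zero : phi2pStep p m 0 = 0 := by
  funext i
  simp [phi2pStep]

lemma iter_zero (k : ℕ) : (phi2pStep p m)^[k] 0 = 0 :=
  Function.iterate_fixed step_zero k

lemma neg_eq_self_imp (hmodd : Odd m) (v : Fin (p - 1) → ZMod m) (h : -v = v) : v = 0 := by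
  funext i
  have h2 : (2 : ZMod m) * v i = 0 := by
    have := congrFun h i
    simp only [Pi.neg_apply] at this
    linear_combination -this
  have hu : IsUnit (2 : ZMod m) := by
    have := (ZMod.isUnit_iff_coprime 2 m).2 (Nat.coprime_two_left.2 hmodd)
    simpa using this
  simpa using (hu.mul_right_eq_zero).1 h2

/-- odd iterates only fix zero -/
lemma fix_odd (hp2 : 2 < p) (hpodd : Odd p) (hmodd : Odd m) (k : ℕ)
    (hk : Odd k) (v : Fin (p - 1) → ZMod m) :
    (phi2pStep p m)^[k] v = v ↔ v = 0 := by
  constructor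
  · intro h
    have a : Function.IsPeriodicPt (phi2pStep p m) k v := h
    have b : Function.IsPeriodicPt (phi2pStep p m) (2 * p) v := iter_two_p hp2 hpodd v
    have c := a.gcd b
    have hd : k.gcd (2 * p) ∣ p := by
      have : Nat.Coprime (k.gcd (2 * p)) 2 :=
        Nat.Coprime.coprime_dvd_left (Nat.gcd_dvd_left _ _) (Nat.coprime_two_right.2 hk)
      exact this.dvd_of_dvd_mul_left (Nat.gcd_dvd_right _ _)
    have d := c.trans_dvd hd
    apply neg_eq_self_imp hmodd
    rw [← iter_p hp2 hpodd]; exact d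
  · rintro rfl; exact iter_zero k

/-- nonzero even iterates fix exactly the alternating vectors -/
lemma fix_even (hp : p.Prime) (hp2 : 2 < p) (hpodd : Odd p) (k : ℕ)
    (hk : Even k) (hk0 : 0 < k) (hkp : k < 2 * p) (v : Fin (p - 1) → ZMod m) :
    (phi2pStep p m)^[k] v = v ↔ phi2pStep p m v = -v := by
  constructor
  · intro h
    have a : Function.IsPeriodicPt (phi2pStep p m) k v := h
    have b : Function.IsPeriodicPt (phi2pStep p m) (2 * p) v := iter_two_p hp2 hpodd v
    have c := a.gcd b
    obtain ⟨j, rfl⟩ := hk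
    rw [← two_mul, Nat.gcd_mul_left] at c
    have : j.gcd p = 1 := Nat.Coprime.symm
      ((Nat.Prime.coprime_iff_not_dvd hp).2 (Nat.not_dvd_of_pos_of_lt (by omega) (by omega)))
    rw [this, mul_one] at c
    rw [← iter_p hp2 hpodd]
    obtain ⟨t, rfl⟩ := hpodd
    have := Function.iterate_succ_apply' (phi2pStep (2 * t + 1) m) (2 * t) v
    exact (this.trans (congrArg _ (c.mul_const t))).symm
  · intro h
    have hneg : phi2pStep p m (-v) = -phi2pStep p m v := by
      funext i
      simp only [phi2pStep, Pi.neg_apply]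
      split_ifs <;> simp
    have h2 : (phi2pStep p m)^[2] v = v := by
      change phi2pStep p m (phi2pStep p m v) = v
      rw [h, hneg, h, neg_neg]
    exact Function.IsPeriodicPt.trans_dvd (f := phi2pStep p m) h2 hk.two_dvd

lemma step_neg_iff (hp2 : 2 < p) (hpodd : Odd p) (v : Fin (p - 1) → ZMod m) :
    phi2pStep p m v = -v ↔
      ∃ c : ZMod m, (p : ZMod m) * c = 0 ∧ v = fun i : Fin (p - 1) => (-1) ^ (i : ℕ) * c := by
  have sum_eq : ∀ c : ZMod m, ∑ k : Fin (p - 1), (-1 : ZMod m) ^ ((k : ℕ) + 1) *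
      ((-1) ^ (k : ℕ) * c) = c - p * c := by
    intro c
    have : ∀ k : Fin (p - 1), (-1 : ZMod m) ^ ((k : ℕ) + 1) * ((-1) ^ (k : ℕ) * c) = -c := by
      intro k
      rw [← mul_assoc, ← pow_add, Odd.neg_one_pow ⟨k, by ring⟩]; ring
    simp only [this, Finset.sum_const, Finset.card_univ, Fintype.card_fin, nsmul_eq_mul]
    rw [Nat.cast_sub (by omega)]
    push_cast; ring
  have hev : (-1 : ZMod m) ^ (p - 2) = -1 := Odd.neg_one_pow (by
    obtain ⟨t, rfl⟩ := hpodd; exact ⟨t - 1, by omega⟩)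
  constructor
  · intro h
    have hv : ∀ i (hi : i < p - 1), v ⟨i, hi⟩ = (-1) ^ i * v ⟨0, by omega⟩ := by
      intro i
      induction i with
      | zero => intro hi; simp
      | succ i ih =>
        intro hi
        have := congrFun h ⟨i, by omega⟩
        simp only [phi2pStep, hi, dif_pos, Pi.neg_apply] at this
        rw [this, ih]; ring
    have hv' : v = fun i : Fin (p - 1) => (-1) ^ (i : ℕ) * v ⟨0, by omega⟩ := by
      funext i; exact hv i i.2
    refine ⟨v ⟨0, by omega⟩, ?_, hv'⟩
    generalize v ⟨0, by omega⟩ = c at hv'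
    subst hv'
    have := congrFun h ⟨p - 2, by omega⟩
    rw [phi2pStep, dif_neg (by simp; omega), sum_eq] at this
    simp only [Pi.neg_apply, hev] at this
    linear_combination -this
  · rintro ⟨c, hc, rfl⟩
    funext i
    simp only [phi2pStep, Pi.neg_apply]
    split_ifs with hi
    · ring
    · rw [sum_eq, show (i : ℕ) = p - 2 by have := i.2; omega, hev, hc]; ring

lemma card_ker (hp : 0 < p) (hm : 0 < m) (hdvd : p ∣ m) :
    Nat.card {c : ZMod m // (p : ZMod m) * c = 0} = p := by
  obtain ⟨q, rfl⟩ := hdvd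
  have hq : 0 < q := Nat.pos_of_mul_pos_left hm
  haveI : NeZero (p * q) := ⟨hm.ne'⟩
  have e : Fin p ≃ {c : ZMod (p * q) // (p : ZMod (p * q)) * c = 0} := by
    refine Equiv.ofBijective (fun j => ⟨((q * j : ℕ) : ZMod (p * q)), ?_⟩) ⟨?_, ?_⟩
    · rw [← Nat.cast_mul, ZMod.natCast_eq_zero_iff]
      exact ⟨j, by ring⟩
    · intro i j h
      have h' := congrArg ZMod.val (congrArg Subtype.val h)
      have lt : ∀ i : Fin p, q * (i : ℕ) < p * q := fun i => by
        rw [mul_comm p]; exact Nat.mul_lt_mul_of_pos_left i.2 hq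
      simp only [ZMod.val_natCast, Nat.mod_eq_of_lt (lt _)] at h'
      exact Fin.ext (Nat.eq_of_mul_eq_mul_left hq h')
    · rintro ⟨c, hc⟩
      have : p * q ∣ p * c.val := by
        rw [← ZMod.natCast_eq_zero_iff]; simpa using hc
      obtain ⟨j, hj⟩ := Nat.dvd_of_mul_dvd_mul_left hp this
      have hlt := ZMod.val_lt c
      refine ⟨⟨j, ?_⟩, ?_⟩
      · rw [hj, mul_comm p] at hlt
        exact Nat.lt_of_mul_lt_mul_left hlt
      · apply Subtype.ext
        simp only
        rw [← hj]; simp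
  rw [← Nat.card_congr e, Nat.card_fin]

lemma card_fix_even (hp2 : 2 < p) (hpodd : Odd p) (hm : 0 < m) (hdvd : p ∣ m) :
    Nat.card {v : Fin (p - 1) → ZMod m // phi2pStep p m v = -v} = p := by
  conv_rhs => rw [← card_ker (by omega) hm hdvd]
  symm
  refine Nat.card_congr (Equiv.ofBijective
    (fun c => ⟨fun i => (-1) ^ (i : ℕ) * c.1, (step_neg_iff hp2 hpodd _).2 ⟨c.1, c.2, rfl⟩⟩)
    ⟨?_, ?_⟩)
  · intro c d h
    have := congrFun (congrArg Subtype.val h) ⟨0, by omega⟩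
    simp only [pow_zero, one_mul] at this
    exact Subtype.ext this
  · rintro ⟨v, hv⟩
    obtain ⟨c, hc, rfl⟩ := (step_neg_iff hp2 hpodd _).1 hv
    exact ⟨⟨c, hc⟩, rfl⟩

lemma sum_pairs (g : ℕ → ℕ) (n : ℕ) : ∑ k ∈ Finset.range (2 * n), g k =
    ∑ i ∈ Finset.range n, (g (2 * i) + g (2 * i + 1)) := by
  induction n with
  | zero => simp
  | succ n ih =>
    rw [show 2 * (n + 1) = 2 * n + 1 + 1 by ring, Finset.sum_range_succ, Finset.sum_range_succ,
      Finset.sum_range_succ, ih]; ring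

/-- Burnside count for a map of finite order dividing `n`. -/
lemma burnside {α : Type} [Finite α] (f : α → α) (n : ℕ) (hn : 0 < n)
    (hf : ∀ v, f^[n] v = v) :
    ∑ k ∈ Finset.range n, Nat.card {v // f^[k] v = v} = (orbitsOf f).ncard * n := by
  classical
  haveI : NeZero n := ⟨hn.ne'⟩
  haveI := Fintype.ofFinite α
  have hmod : ∀ k v, f^[k % n] v = f^[k] v := fun k v =>
    Function.IsPeriodicPt.iterate_mod_apply (f := f) (hf v) k
  letI act : MulAction (Multiplicative (ZMod n)) α :=
    { smul := fun g v => f^[(Multiplicative.toAdd g).val] v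
      one_smul := fun v => by
        change f^[(0 : ZMod n).val] v = v
        simp
      mul_smul := fun a b v => by
        change f^[(Multiplicative.toAdd a + Multiplicative.toAdd b).val] v = f^[_] (f^[_] v)
        rw [ZMod.val_add, hmod, Function.iterate_add_apply] }
  have smul_def : ∀ (g : Multiplicative (ZMod n)) (v : α),
    g • v = f^[(Multiplicative.toAdd g).val] v := fun _ _ => rfl
  have horb : ∀ v, MulAction.orbit (Multiplicative (ZMod n)) v = orbitOf f v := by
    intro v
    ext w
    constructor
    · rintro ⟨g, rfl⟩
      exact ⟨_, rfl⟩
    · rintro ⟨k, rfl⟩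
      refine ⟨Multiplicative.ofAdd (k : ZMod n), ?_⟩
      change f^[(k : ZMod n).val] v = _
      rw [ZMod.val_natCast, hmod]
  have hcard : (orbitsOf f).ncard =
      Nat.card (Quotient (MulAction.orbitRel (Multiplicative (ZMod n)) α)) := by
    have : orbitsOf f = Set.range
        (MulAction.orbitRel.Quotient.orbit (G := Multiplicative (ZMod n)) (α := α)) := by
      ext s
      constructor
      · rintro ⟨v, rfl⟩
        exact ⟨Quotient.mk'' v, by rw [MulAction.orbitRel.Quotient.orbit_mk, horb]⟩
      · rintro ⟨q, rfl⟩
        induction q using Quotient.inductionOn' with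
        | h v => exact ⟨v, by rw [MulAction.orbitRel.Quotient.orbit_mk, horb]⟩
    rw [this, ← Set.image_univ,
      Set.ncard_image_of_injective _ MulAction.orbitRel.Quotient.orbit_injective, Set.ncard_univ]
  have B := MulAction.sum_card_fixedBy_eq_card_orbits_mul_card_group
    (Multiplicative (ZMod n)) α
  rw [hcard, Nat.card_eq_fintype_card]
  rw [Fintype.card_multiplicative, ZMod.card] at B
  rw [← B, Finset.sum_range]
  symm
  refine Fintype.sum_bijective
    (fun g : Multiplicative (ZMod n) =>
      (⟨(Multiplicative.toAdd g).val, ZMod.val_lt _⟩ : Fin n)) ⟨?_, ?_⟩ _ _ ?_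
  · intro a b h
    exact Multiplicative.toAdd.injective (ZMod.val_injective n (Fin.mk.inj h))
  · intro j
    refine ⟨Multiplicative.ofAdd ((j : ℕ) : ZMod n), Fin.ext ?_⟩
    change ((j : ℕ) : ZMod n).val = j
    rw [ZMod.val_natCast, Nat.mod_eq_of_lt j.2]
  · intro g
    rw [← Nat.card_eq_fintype_card]
    rfl

end Phi2p

open Phi2p

/-- for an odd prime `p` and odd `m ≥ 1` with `p ∣ m`, the number
of orbits of the Φ_{2p} state map is `(m^(p-1) - p)/(2p) + 1 + (p-1)/2`. -/
theorem phi2p_orbit_count_p_dvd_m_odd (p m : ℕ) (hp : p.Prime) (hpodd : Odd p)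
    (hm : 0 < m) (hdvd : p ∣ m) (hmodd : Odd m) :
    (orbitsOf (phi2pStep p m)).ncard = (m ^ (p - 1) - p) / (2 * p) + 1 + (p - 1) / 2 := by
  have hp2 : 2 < p := by
    have := hp.two_le
    rcases hpodd with ⟨t, rfl⟩
    omega
  haveI : NeZero m := ⟨hm.ne'⟩
  have B := burnside (phi2pStep p m) (2 * p) (by omega) (iter_two_p hp2 hpodd)
  generalize (orbitsOf (phi2pStep p m)).ncard = N at B
  have h0 : Nat.card {v // (phi2pStep p m)^[0] v = v} = m ^ (p - 1) := by
    simp [Nat.card_congr (Equiv.subtypeUnivEquiv (p := fun v => v = v)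
      (α := Fin (p - 1) → ZMod m) fun _ => rfl)]
  have hodd : ∀ i, Nat.card {v // (phi2pStep p m)^[2 * i + 1] v = v} = 1 := by
    intro i
    simp only [fix_odd hp2 hpodd hmodd (2 * i + 1) ⟨i, rfl⟩]
    simp
  have heven : ∀ i, i < p - 1 → Nat.card {v // (phi2pStep p m)^[2 * (i + 1)] v = v} = p := by
    intro i hi
    simp only [fix_even (m := m) hp hp2 hpodd (2 * (i + 1)) (even_two_mul _) (by omega) (by omega)]
    exact card_fix_even hp2 hpodd hm hdvd
  rw [sum_pairs, Finset.sum_add_distrib] at B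
  simp only [hodd] at B
  have E : ∑ i ∈ Finset.range p, Nat.card {v // (phi2pStep p m)^[2 * i] v = v}
      = m ^ (p - 1) + (p - 1) * p := by
    have : ∀ q, q = p - 1 → ∑ i ∈ Finset.range (q + 1),
        Nat.card {v // (phi2pStep p m)^[2 * i] v = v} = m ^ (p - 1) + (p - 1) * p := by
      rintro q hq
      rw [Finset.sum_range_succ', mul_zero, h0, Finset.sum_congr rfl
        (fun i hi => heven i (by rw [← hq]; exact Finset.mem_range.1 hi)), add_comm]
      simp [hq]
    have h := this (p - 1) rfl
    rwa [show p - 1 + 1 = p by omega] at h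
  rw [E] at B
  simp only [Finset.sum_const, Finset.card_range, smul_eq_mul, mul_one] at B
  have hle : p ≤ m ^ (p - 1) :=
    Nat.le_of_dvd (by positivity) (hdvd.trans (dvd_pow_self m (by omega)))
  generalize m ^ (p - 1) = M at *
  obtain ⟨t, rfl⟩ := hpodd
  simp only [Nat.add_sub_cancel] at B ⊢
  have hN : 1 + t ≤ N := by
    by_contra hlt
    have : N ≤ t := by omega
    nlinarith
  obtain ⟨X, rfl⟩ := Nat.exists_eq_add_of_le hN
  have hM : M - (2 * t + 1) = (2 * (2 * t + 1)) * X := by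
    have : M = (2 * t + 1) + (2 * (2 * t + 1)) * X := by nlinarith
    omega
  rw [hM, Nat.mul_div_cancel_left _ (by omega), Nat.mul_div_cancel_left _ (by omega)]
  ring
end

section
/- Let p be an odd prime and m a positive even integer with p ∤ m. Then the number of orbits of the Φ_{2p} state map on (ℤ/mℤ)^(p-1) equals (m^(p-1) − 2^(p-1))/(2p) + 1 + (2^(p-1) − 1)/p. -/
open Function in
theorem aux_orbit_eq_of_mem {α : Type*} (f : α → α) (N : ℕ) (hN : 0 < N)
    (hf : ∀ x, f^[N] x = x) (x : α) (k : ℕ) : orbitOf f (f^[k] x) = orbitOf f x := by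
  ext w
  constructor
  · rintro ⟨j, rfl⟩
    exact ⟨j + k, by rw [iterate_add_apply]⟩
  · rintro ⟨j, rfl⟩
    refine ⟨j + (N * k - k), ?_⟩
    have h1 : k ≤ N * k := Nat.le_mul_of_pos_left k hN
    rw [← iterate_add_apply, add_assoc, Nat.sub_add_cancel h1, iterate_add_apply]
    congr 1
    exact (IsPeriodicPt.mul_const (show IsPeriodicPt f N x from hf x) k)

open Function in
theorem aux_count {α : Type*} [Fintype α] [DecidableEq α] (f : α → α) (N : ℕ) (hN : 0 < N)
    (hf : ∀ x, f^[N] x = x) (S : Finset α) (d : ℕ)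
    (hS : ∀ x ∈ S, minimalPeriod f x = d)
    (hinv : ∀ x, minimalPeriod f x = d → x ∈ S) :
    (orbitOf f '' (S : Set α)).ncard * d = S.card := by
  classical
  have hper : ∀ x, x ∈ periodicPts f := fun x => mk_mem_periodicPts hN (hf x)
  have h := Finset.card_eq_sum_card_image (orbitOf f) S
  have h2 : ∀ b ∈ S.image (orbitOf f), (S.filter (fun x => orbitOf f x = b)).card = d := by
    intro b hb
    obtain ⟨y, hy, rfl⟩ := Finset.mem_image.1 hb
    have hy' := hS y hy
    have : S.filter (fun x => orbitOf f x = orbitOf f y)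
        = (Finset.range d).image (fun k => f^[k] y) := by
      ext x
      simp only [Finset.mem_filter, Finset.mem_image, Finset.mem_range]
      constructor
      · rintro ⟨_, hx⟩
        have : x ∈ orbitOf f y := by rw [← hx]; exact ⟨0, rfl⟩
        obtain ⟨k, rfl⟩ := this
        refine ⟨k % d, ?_, ?_⟩
        · apply Nat.mod_lt
          rw [← hy']
          exact minimalPeriod_pos_of_mem_periodicPts (hper y)
        · rw [← hy', iterate_mod_minimalPeriod_eq]
      · rintro ⟨k, hk, rfl⟩
        refine ⟨hinv _ ?_, aux_orbit_eq_of_mem f N hN hf y k⟩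
        rw [minimalPeriod_apply_iterate (hper y), hy']
    rw [this, Finset.card_image_of_injOn, Finset.card_range]
    intro i hi j hj hij
    simp only [Finset.coe_range, Set.mem_Iio] at hi hj
    rw [← hy'] at hi hj
    exact iterate_injOn_Iio_minimalPeriod hi hj hij
  rw [h, Finset.sum_congr rfl h2, Finset.sum_const, smul_eq_mul, ← Finset.coe_image,
    Set.ncard_coe_finset]

open Function in
theorem aux_disj {α : Type*} (f : α → α) (N : ℕ) (hN : 0 < N)
    (hf : ∀ x, f^[N] x = x) (S T : Set α) (d e : ℕ) (hde : d ≠ e)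
    (hS : ∀ x ∈ S, minimalPeriod f x = d) (hT : ∀ x ∈ T, minimalPeriod f x = e) :
    Disjoint (orbitOf f '' S) (orbitOf f '' T) := by
  rw [Set.disjoint_left]
  rintro _ ⟨x, hx, rfl⟩ ⟨y, hy, hxy⟩
  have : x ∈ orbitOf f y := by rw [hxy]; exact ⟨0, rfl⟩
  obtain ⟨k, rfl⟩ := this
  have h1 := hS _ hx
  rw [minimalPeriod_apply_iterate (mk_mem_periodicPts hN (hf y)), hT y hy] at h1
  exact hde h1.symm

section aux
variable {p m : ℕ}

theorem aux_iter (v : Fin (p - 1) → ZMod m) (h0 : 0 < p - 1) (i : ℕ) :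
    ∀ (n : ℕ) (hi : i < p - 1), (phi2pStep p m)^[n] v ⟨i, hi⟩ =
      (phi2pStep p m)^[n + i] v ⟨0, h0⟩ := by
  induction i with
  | zero => intro n hi; rfl
  | succ i ih =>
    intro n hi
    have := ih (n + 1) (by omega)
    rw [show n + (i + 1) = n + 1 + i by ring, ← this, Function.iterate_succ_apply']
    simp [phi2pStep, hi]

theorem aux_rec (v : Fin (p - 1) → ZMod m) (h0 : 0 < p - 1) (hp : Even (p - 1)) (n : ℕ) :
    ∑ k ∈ Finset.range p, (-1 : ZMod m) ^ k * (phi2pStep p m)^[n + k] v ⟨0, h0⟩ = 0 := by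
  have e : p = (p - 1) + 1 := by omega
  have h1 : (phi2pStep p m)^[n + (p - 1)] v ⟨0, h0⟩ =
      ∑ k : Fin (p - 1), (-1 : ZMod m) ^ ((k : ℕ) + 1) * (phi2pStep p m)^[n] v k := by
    have := aux_iter v h0 (p - 1 - 1) (n + 1) (by omega)
    rw [show n + (p - 1) = n + 1 + (p - 1 - 1) by omega, ← this, Function.iterate_succ_apply']
    have h : ¬ (p - 1 - 1 + 1 < p - 1) := by omega
    simp [phi2pStep, h]
  have h2 : ∀ s : ℕ, s = p - 1 → ∑ k ∈ Finset.range (s + 1),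
      (-1 : ZMod m) ^ k * (phi2pStep p m)^[n + k] v ⟨0, h0⟩ = 0 := by
    intro s hs
    rw [Finset.sum_range_succ, hs, hp.neg_one_pow, one_mul, h1, Finset.sum_range,
      ← Finset.sum_add_distrib]
    apply Finset.sum_eq_zero
    intro k _
    rw [← aux_iter v h0 k n k.2]
    ring
  have := h2 (p - 1) rfl
  rwa [← e] at this

theorem aux_neg (v : Fin (p - 1) → ZMod m) (h0 : 0 < p - 1) (hp : Even (p - 1)) :
    (phi2pStep p m)^[p] v = -v := by
  have key : ∀ n, (phi2pStep p m)^[n + p] v ⟨0, h0⟩ = - (phi2pStep p m)^[n] v ⟨0, h0⟩ := by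
    intro n
    have h1 := aux_rec v h0 hp n
    have h2 := aux_rec v h0 hp (n + 1)
    have h3 := Finset.sum_range_succ
      (fun k => (-1 : ZMod m) ^ k * (phi2pStep p m)^[n + k] v ⟨0, h0⟩) p
    rw [h1, Finset.sum_range_succ'] at h3
    have h4 : ∑ k ∈ Finset.range p, (-1 : ZMod m) ^ (k + 1) *
        (phi2pStep p m)^[n + (k + 1)] v ⟨0, h0⟩ = 0 := by
      rw [← neg_eq_zero, ← Finset.sum_neg_distrib, ← h2]
      refine Finset.sum_congr rfl fun k _ => ?_
      rw [show n + (k + 1) = n + 1 + k by ring]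
      ring
    rw [h4] at h3
    have h5 : (-1 : ZMod m) ^ p = -1 := by
      have : Odd p := by
        have := hp.add_one
        rwa [Nat.sub_add_cancel (by omega)] at this
      exact this.neg_one_pow
    rw [h5] at h3
    simp only [pow_zero, one_mul, add_zero, zero_add] at h3
    rw [h3]
    ring
  ext ⟨i, hi⟩
  rw [aux_iter v h0 i p hi, add_comm, key, Pi.neg_apply]
  congr 1
  have := aux_iter v h0 i 0 hi
  simpa using this.symm

theorem aux_two (v : Fin (p - 1) → ZMod m) (h0 : 0 < p - 1) (hp : Even (p - 1))
    (hc : Nat.Coprime p m) (hv : (phi2pStep p m)^[2] v = v) : v = 0 := by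
  have h1 : phi2pStep p m v = -v := by
    rw [← aux_neg v h0 hp]
    obtain ⟨j, hj⟩ := hp
    have hs : ∀ n, n = 1 + 2 * j → phi2pStep p m v = (phi2pStep p m)^[n] v := by
      rintro n rfl
      rw [Function.iterate_add_apply]
      have : (phi2pStep p m)^[2 * j] v = v :=
        Function.IsPeriodicPt.mul_const
          (show Function.IsPeriodicPt (phi2pStep p m) 2 v from hv) j
      rw [this]
      rfl
    exact hs p (by omega)
  have hneg : phi2pStep p m (-v) = v := by
    rw [← h1]; exact hv
  have h2 : ∀ n, (phi2pStep p m)^[n] v = (-1 : ZMod m) ^ n • v := by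
    intro n
    rcases Nat.even_or_odd' n with ⟨j, rfl | rfl⟩
    · have : (phi2pStep p m)^[2 * j] v = v :=
        Function.IsPeriodicPt.mul_const
          (show Function.IsPeriodicPt (phi2pStep p m) 2 v from hv) j
      rw [this]; simp
    · have : (phi2pStep p m)^[2 * j] v = v :=
        Function.IsPeriodicPt.mul_const
          (show Function.IsPeriodicPt (phi2pStep p m) 2 v from hv) j
      rw [Function.iterate_succ_apply', this, h1]; simp [pow_succ]
  have h3 := aux_rec v h0 hp 0
  have h4 : (p : ZMod m) * v ⟨0, h0⟩ = 0 := by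
    rw [← h3, Finset.sum_congr rfl (g := fun _ => v ⟨0, h0⟩)]
    · simp
    · intro k _
      rw [h2]
      simp only [zero_add, Pi.smul_apply, smul_eq_mul, ← mul_assoc, ← mul_pow]
      simp
  have h5 : v ⟨0, h0⟩ = 0 := by
    have hu : IsUnit (p : ZMod m) := (ZMod.unitOfCoprime p hc).isUnit
    exact (hu.mul_right_eq_zero).1 h4
  ext ⟨i, hi⟩
  have := aux_iter v h0 i 0 hi
  rw [h2] at this
  simp only [pow_zero, one_smul, h2] at this
  rw [this]
  simp [h5]

end aux

theorem aux_tors (m q : ℕ) [NeZero m] (hm : Even m) :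
    (Finset.univ.filter (fun v : Fin q → ZMod m => -v = v)).card = 2 ^ q := by
  obtain ⟨r, hr⟩ := hm
  have hm0 : 0 < m := Nat.pos_of_ne_zero (NeZero.ne m)
  have h1 : (Finset.univ.filter (fun x : ZMod m => -x = x)) = {0, (r : ZMod m)} := by
    ext x
    simp only [Finset.mem_filter, Finset.mem_univ, true_and, Finset.mem_insert,
      Finset.mem_singleton]
    rw [ZMod.neg_eq_self_iff]
    apply or_congr Iff.rfl
    constructor
    · intro h
      rw [← ZMod.natCast_zmod_val x, show x.val = r by omega]
    · rintro rfl
      rw [ZMod.val_natCast, Nat.mod_eq_of_lt (by omega)]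
      omega
  have h2 : (Finset.univ.filter (fun v : Fin q → ZMod m => -v = v)) =
      Fintype.piFinset (fun _ => Finset.univ.filter (fun x : ZMod m => -x = x)) := by
    ext v
    simp [Fintype.mem_piFinset, funext_iff]
  rw [h2, Fintype.card_piFinset, h1, Finset.card_pair]
  · simp
  · intro h
    have := congrArg ZMod.val h
    rw [ZMod.val_natCast, Nat.mod_eq_of_lt (by omega), ZMod.val_zero] at this
    omega

/-- for an odd prime `p` and even `m ≥ 1` with `p ∤ m`, the number
of orbits of the Φ_{2p} state map is
`(m^(p-1) - 2^(p-1))/(2p) + 1 + (2^(p-1) - 1)/p`. -/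
theorem phi2p_orbit_count_m_even_not_p_dvd (p m : ℕ) (hp : p.Prime) (hpodd : Odd p)
    (hm : 0 < m) (hmeven : Even m) (hndvd : ¬ p ∣ m) :
    (orbitsOf (phi2pStep p m)).ncard =
      (m ^ (p - 1) - 2 ^ (p - 1)) / (2 * p) + 1 + (2 ^ (p - 1) - 1) / p := by
  classical
  haveI : NeZero m := ⟨hm.ne'⟩
  have hp2 := hp.two_le
  have h0 : 0 < p - 1 := by omega
  have hev : Even (p - 1) := by
    obtain ⟨j, hj⟩ := hpodd
    exact ⟨j, by omega⟩
  have hc : Nat.Coprime p m := (Nat.Prime.coprime_iff_not_dvd hp).2 hndvd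
  have hp3 : p ≠ 2 := by rintro rfl; exact absurd hpodd (by decide)
  set f := phi2pStep p m with hfdef
  have hneg : ∀ v, f^[p] v = -v := fun v => aux_neg v h0 hev
  have htwo : ∀ v, f^[2] v = v → v = 0 := fun v => aux_two v h0 hev hc
  have hf : ∀ v, f^[2 * p] v = v := by
    intro v
    rw [two_mul, Function.iterate_add_apply, hneg, hneg, neg_neg]
  have hN : 0 < 2 * p := by omega
  have hz : f 0 = 0 := by
    ext i
    simp [hfdef, phi2pStep]
  have m1 : Function.minimalPeriod f 0 = 1 :=
    Function.minimalPeriod_eq_one_iff_isFixedPt.2 hz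
  have hnf : ∀ v, v ≠ 0 → ¬ Function.minimalPeriod f v ∣ 2 := by
    intro v hv hd
    exact hv (htwo v (Function.isPeriodicPt_iff_minimalPeriod_dvd.2 hd))
  have m2 : ∀ v, v ≠ 0 → -v = v → Function.minimalPeriod f v = p := by
    intro v hv hvv
    have hd : Function.minimalPeriod f v ∣ p :=
      Function.isPeriodicPt_iff_minimalPeriod_dvd.1 ((hneg v).trans hvv)
    rcases (Nat.dvd_prime hp).1 hd with h | h
    · exact absurd (by rw [h]; exact one_dvd 2) (hnf v hv)
    · exact h
  have m3 : ∀ v, -v ≠ v → Function.minimalPeriod f v = 2 * p := by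
    intro v hvv
    have hv : v ≠ 0 := by rintro rfl; simp at hvv
    have hd : Function.minimalPeriod f v ∣ 2 * p :=
      Function.isPeriodicPt_iff_minimalPeriod_dvd.1 (hf v)
    have hnp : ¬ Function.minimalPeriod f v ∣ p := by
      intro h
      have h' : f^[p] v = v := Function.isPeriodicPt_iff_minimalPeriod_dvd.2 h
      exact hvv ((hneg v).symm.trans h')
    have hn2 := hnf v hv
    obtain ⟨a, b, ha, hb, hab⟩ := (Nat.dvd_mul).1 hd
    rcases (Nat.dvd_prime Nat.prime_two).1 ha with rfl | rfl
    · exact absurd (by rw [← hab, one_mul]; exact hb) hnp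
    · rcases (Nat.dvd_prime hp).1 hb with rfl | rfl
      · exact absurd (by rw [← hab]) hn2
      · exact hab.symm
  let T : Finset (Fin (p - 1) → ZMod m) := Finset.univ.filter (fun v => -v = v)
  let S1 : Finset (Fin (p - 1) → ZMod m) := {0}
  let S2 : Finset (Fin (p - 1) → ZMod m) := T.erase 0
  let S3 : Finset (Fin (p - 1) → ZMod m) := Finset.univ \ T
  have e1 : ∀ v ∈ S1, Function.minimalPeriod f v = 1 := by
    intro v hv
    rw [Finset.mem_singleton.1 hv, m1]
  have e2 : ∀ v ∈ S2, Function.minimalPeriod f v = p := by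
    intro v hv
    simp only [S2, T, Finset.mem_erase, Finset.mem_filter, Finset.mem_univ, true_and] at hv
    exact m2 v hv.1 hv.2
  have e3 : ∀ v ∈ S3, Function.minimalPeriod f v = 2 * p := by
    intro v hv
    simp only [S3, T, Finset.mem_sdiff, Finset.mem_filter, Finset.mem_univ, true_and] at hv
    exact m3 v hv
  have hcov : ∀ v, v ∈ S1 ∨ v ∈ S2 ∨ v ∈ S3 := by
    intro v
    simp only [S1, S2, S3, T, Finset.mem_sdiff, Finset.mem_filter, Finset.mem_univ, true_and,
      Finset.mem_erase, Finset.mem_singleton]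
    tauto
  have c1 := aux_count f _ hN hf S1 1 e1 (fun v hv => by
    rcases hcov v with h | h | h
    · exact h
    · have := e2 v h; omega
    · have := e3 v h; omega)
  have c2 := aux_count f _ hN hf S2 p e2 (fun v hv => by
    rcases hcov v with h | h | h
    · have := e1 v h; omega
    · exact h
    · have := e3 v h; omega)
  have c3 := aux_count f _ hN hf S3 (2 * p) e3 (fun v hv => by
    rcases hcov v with h | h | h
    · have := e1 v h; omega
    · have := e2 v h; omega
    · exact h)
  have hT : T.card = 2 ^ (p - 1) := aux_tors m (p - 1) hmeven
  have k1 : S1.card = 1 := Finset.card_singleton 0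
  have k2 : S2.card = 2 ^ (p - 1) - 1 := by
    rw [← hT]
    exact Finset.card_erase_of_mem (by simp [T])
  have k3 : S3.card = m ^ (p - 1) - 2 ^ (p - 1) := by
    rw [← hT]
    simp only [S3]
    rw [Finset.card_sdiff_of_subset (Finset.subset_univ _), Finset.card_univ]
    simp [ZMod.card]
  have hunion : orbitsOf f = (orbitOf f '' (S3 : Set _) ∪ orbitOf f '' (S1 : Set _)) ∪
      orbitOf f '' (S2 : Set _) := by
    rw [← Set.image_union, ← Set.image_union, orbitsOf, ← Set.image_univ]
    congr 1
    symm
    rw [Set.eq_univ_iff_forall]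
    intro v
    simp only [Set.mem_union, Finset.mem_coe]
    have := hcov v
    tauto
  have d31 := aux_disj f _ hN hf S3 S1 (2 * p) 1 (by omega) e3 e1
  have d32 := aux_disj f _ hN hf S3 S2 (2 * p) p (by omega) e3 e2
  have d12 := aux_disj f _ hN hf S1 S2 1 p (by omega) e1 e2
  rw [hunion, Set.ncard_union_eq (Set.disjoint_union_left.2 ⟨d32, d12⟩) (Set.toFinite _)
    (Set.toFinite _), Set.ncard_union_eq d31 (Set.toFinite _) (Set.toFinite _),
    ← k3, ← k2, ← c3, ← c2, Nat.mul_div_cancel _ hN, Nat.mul_div_cancel _ hp.pos]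
  rw [k1, mul_one] at c1
  rw [c1]
end

section
/- Let p be an odd prime and m a positive integer with 2p ∣ m. Then the number of orbits of the Φ_{2p} state map on (ℤ/mℤ)^(p-1) equals (m^(p-1) − 2^(p-1) − p + 1)/(2p) + 1 + (p−1)/2 + (2^(p-1) − 1)/p; specifically, there is exactly one fixed point (the zero vector), exactly (p−1)/2 orbits of length 2, exactly (2^(p-1) − 1)/p orbits of length p, and exactly (m^(p-1) − 2^(p-1) − p + 1)/(2p) orbits of length 2p. -/
open Function in
lemma orbitOf_ncard {α : Type*} (f : α → α) (v : α) (hv : v ∈ periodicPts f) :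
    (orbitOf f v).ncard = minimalPeriod f v := by
  have h : orbitOf f v = (fun k => f^[k] v) '' Set.Iio (minimalPeriod f v) := by
    ext w
    constructor
    · rintro ⟨k, rfl⟩
      exact ⟨k % minimalPeriod f v,
        Nat.mod_lt _ (minimalPeriod_pos_of_mem_periodicPts hv), iterate_mod_minimalPeriod_eq⟩
    · rintro ⟨k, _, rfl⟩
      exact ⟨k, rfl⟩
  rw [h, Set.ncard_image_of_injOn iterate_injOn_Iio_minimalPeriod]
  rw [← Finset.coe_Iio, Set.ncard_coe_finset, Nat.card_Iio]

open Function in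
lemma orbitOf_eq_of_mem {α : Type*} (f : α → α) (v w : α) (hv : v ∈ periodicPts f)
    (hw : w ∈ orbitOf f v) : orbitOf f w = orbitOf f v := by
  obtain ⟨k, rfl⟩ := hw
  obtain ⟨n, hn, hper⟩ := hv
  ext u
  constructor
  · rintro ⟨j, rfl⟩
    exact ⟨j + k, iterate_add_apply f j k v⟩
  · rintro ⟨j, rfl⟩
    refine ⟨j + (n * k - k), ?_⟩
    rw [← iterate_add_apply]
    have h1 : j + (n * k - k) + k = j + n * k := by
      have : k ≤ n * k := Nat.le_mul_of_pos_left k hn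
      omega
    rw [h1, iterate_add_apply, (hper.mul_const k : f^[n * k] v = v)]

open Function in
lemma orbits_count {α : Type*} [Finite α] (f : α → α) (hf : ∀ v, v ∈ periodicPts f) (d : ℕ) :
    {v | minimalPeriod f v = d}.ncard = {O ∈ orbitsOf f | O.ncard = d}.ncard * d := by
  classical
  have := Fintype.ofFinite α
  set s : Finset α := Finset.univ.filter (fun v => minimalPeriod f v = d) with hs
  have h1 : {v | minimalPeriod f v = d} = (s : Set α) := by ext; simp [hs]
  have h2 : {O ∈ orbitsOf f | O.ncard = d} = ((s.image (orbitOf f) : Finset (Set α)) : Set (Set α)) := by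
    ext O
    simp only [orbitsOf, Set.mem_ofPred_eq, Finset.coe_image, Set.mem_image, Set.mem_range, hs,
      Finset.coe_filter, Finset.mem_univ, true_and]
    constructor
    · rintro ⟨⟨v, rfl⟩, h⟩
      exact ⟨v, by rw [← orbitOf_ncard f v (hf v), h], rfl⟩
    · rintro ⟨v, h, rfl⟩
      exact ⟨⟨v, rfl⟩, by rw [orbitOf_ncard f v (hf v), h]⟩
  rw [h1, h2, Set.ncard_coe_finset, Set.ncard_coe_finset,
    Finset.card_eq_sum_card_image (orbitOf f) s]
  rw [Finset.sum_const_nat (m := d)]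
  intro O hO
  obtain ⟨v, hv, rfl⟩ := Finset.mem_image.1 hO
  have hv' : minimalPeriod f v = d := by simpa [hs] using hv
  rw [← Set.ncard_coe_finset, ← hv', ← orbitOf_ncard f v (hf v)]
  congr 1
  ext w
  simp only [Finset.coe_filter, Set.mem_ofPred_eq, hs, Finset.mem_univ, true_and]
  constructor
  · rintro ⟨_, h⟩
    rw [← h]
    exact ⟨0, rfl⟩
  · intro h
    have := orbitOf_eq_of_mem f v w (hf v) h
    have hw : minimalPeriod f w = d := by
      rw [← orbitOf_ncard f w (hf w), this, orbitOf_ncard f v (hf v), hv']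
    exact ⟨by simpa using hw, this⟩

lemma zmod_torsion_card (m d : ℕ) (hm : 0 < m) (hd : d ∣ m) :
    {a : ZMod m | (d : ZMod m) * a = 0}.ncard = d := by
  have : NeZero m := ⟨hm.ne'⟩
  have h := IsAddCyclic.card_nsmulAddMonoidHom_ker (G := ZMod m) d
  rw [Nat.card_zmod, Nat.gcd_eq_right hd] at h
  have h2 : {a : ZMod m | (d : ZMod m) * a = 0} =
      ((nsmulAddMonoidHom d : ZMod m →+ ZMod m).ker : Set (ZMod m)) := by
    ext a
    simp [AddMonoidHom.mem_ker]
  rw [h2, ← Nat.card_coe_set_eq]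
  exact h

lemma phi2p_seq (p m : ℕ) (hp : 3 ≤ p) (hpodd : Odd p) (v : Fin (p - 1) → ZMod m) :
    ∃ a : ℕ → ZMod m, (∀ n (i : Fin (p - 1)), (phi2pStep p m)^[n] v i = a (n + i)) ∧
      ∀ n, ∑ k ∈ Finset.range p, (-1) ^ k * a (n + k) = 0 := by
  have h0 : 0 < p - 1 := by omega
  have key : ∀ i (hi : i < p - 1) n,
      (phi2pStep p m)^[n] v ⟨i, hi⟩ = (phi2pStep p m)^[n + i] v ⟨0, h0⟩ := by
    intro i
    induction i with
    | zero => intro hi n; rfl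
    | succ i ih =>
      intro hi n
      have := ih (by omega) (n + 1)
      rw [Function.iterate_succ_apply'] at this
      rw [show n + (i + 1) = n + 1 + i by ring, ← this]
      simp [phi2pStep, hi]
  refine ⟨fun n => (phi2pStep p m)^[n] v ⟨0, h0⟩, fun n i => key i i.2 n, fun n => ?_⟩
  have h1 := key (p - 2) (by omega) (n + 1)
  rw [Function.iterate_succ_apply'] at h1
  have h2 : ¬ (p - 2 + 1 < p - 1) := by omega
  simp only [phi2pStep, h2, dite_false] at h1
  obtain ⟨q, rfl⟩ : ∃ q, p = q + 1 := ⟨p - 1, by omega⟩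
  have hq : Even q := by
    rw [Nat.odd_add_one] at hpodd
    simpa using hpodd
  rw [Finset.sum_range_succ, hq.neg_one_pow, one_mul]
  have h3 : n + 1 + (q + 1 - 2) = n + q := by omega
  rw [h3] at h1
  change _ + (phi2pStep (q + 1) m)^[n + q] v ⟨0, h0⟩ = 0
  have h4 : (phi2pStep (q + 1) m)^[n + q] v ⟨0, h0⟩ =
     ∑ k : Fin q, (-1 : ZMod m) ^ ((k : ℕ) + 1) * (phi2pStep (q + 1) m)^[n] v k := h1.symm
  rw [h4, ← Fin.sum_univ_eq_sum_range (fun k => (-1) ^ k * (phi2pStep (q + 1) m)^[n + k] v ⟨0, h0⟩) q,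
    ← Finset.sum_add_distrib]
  apply Finset.sum_eq_zero
  intro k _
  have := key k k.2 n
  rw [← this, pow_succ]
  simp

lemma alt_antiperiod {R : Type*} [CommRing R] (p : ℕ) (hpodd : Odd p) (a : ℕ → R)
    (h : ∀ n, ∑ k ∈ Finset.range p, (-1) ^ k * a (n + k) = 0) (n : ℕ) : a (n + p) = - a n := by
  have h1 : ∀ q, ∑ k ∈ Finset.range q, (-1) ^ k * a (n + k)
      + ∑ k ∈ Finset.range q, (-1) ^ k * a (n + 1 + k) = a n - (-1) ^ q * a (n + q) := by
    intro q
    induction q with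
    | zero => simp
    | succ q ih =>
      rw [Finset.sum_range_succ, Finset.sum_range_succ, add_add_add_comm, ih,
        show n + 1 + q = n + (q + 1) by ring]
      ring
  have h2 := h1 p
  rw [h, h, hpodd.neg_one_pow] at h2
  linear_combination -h2

lemma phi2p_iter_p (p m : ℕ) (hp : 3 ≤ p) (hpodd : Odd p) (v : Fin (p - 1) → ZMod m) :
    (phi2pStep p m)^[p] v = - v := by
  obtain ⟨a, ha, hs⟩ := phi2p_seq p m hp hpodd v
  ext i
  have h0 := ha 0 i
  rw [zero_add] at h0
  rw [ha, Pi.neg_apply, show v i = a i from h0, add_comm, alt_antiperiod p hpodd a hs]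

/-- The alternating vector. -/
def altVec (p m : ℕ) (a : ZMod m) : Fin (p - 1) → ZMod m := fun i => (-1) ^ (i : ℕ) * a

lemma phi2p_altVec (p m : ℕ) (hp : 3 ≤ p) (hpodd : Odd p) (a : ZMod m)
    (ha : (p : ZMod m) * a = 0) : phi2pStep p m (altVec p m a) = altVec p m (-a) := by
  ext i
  by_cases h : (i : ℕ) + 1 < p - 1
  · simp [phi2pStep, h, altVec, pow_succ]
  · simp only [phi2pStep, h, altVec, dite_false]
    have h1 : ∀ k : Fin (p - 1), (-1 : ZMod m) ^ ((k : ℕ) + 1) * ((-1) ^ (k : ℕ) * a) = -a := by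
      intro k
      have : (-1 : ZMod m) ^ (k : ℕ) * (-1) ^ (k : ℕ) = 1 := by
        rw [← mul_pow]; simp
      rw [pow_succ]
      linear_combination (-a) * this
    have h2 : Odd (i : ℕ) := by
      have := i.2
      obtain ⟨r, hr⟩ := hpodd
      exact ⟨r - 1, by omega⟩
    rw [Finset.sum_congr rfl (fun k _ => h1 k), Finset.sum_const, Finset.card_univ,
      Fintype.card_fin, nsmul_eq_mul, Nat.cast_sub (by omega), h2.neg_one_pow]
    push_cast
    linear_combination -ha

lemma phi2p_fix_two (p m : ℕ) (hp : 3 ≤ p) (hpodd : Odd p) :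
    {v | (phi2pStep p m)^[2] v = v} = altVec p m '' {a : ZMod m | (p : ZMod m) * a = 0} := by
  ext v
  constructor
  · intro hv
    obtain ⟨a, ha, hs⟩ := phi2p_seq p m hp hpodd v
    have hap := alt_antiperiod p hpodd a hs
    have hv' : Function.IsPeriodicPt (phi2pStep p m) 2 v := hv
    have h2 : ∀ n, a (n + 2) = a n := by
      intro n
      have h1 := ha (n + 2) ⟨0, by omega⟩
      have h3 := ha n ⟨0, by omega⟩
      rw [Function.iterate_add_apply, show (phi2pStep p m)^[2] v = v from hv, h3] at h1
      exact h1.symm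
    have h2' : ∀ k n, a (n + 2 * k) = a n := by
      intro k
      induction k with
      | zero => intro n; rfl
      | succ k ih => intro n; rw [mul_add, ← add_assoc, mul_one, h2, ih]
    have h1 : ∀ n, a (n + 1) = - a n := by
      intro n
      obtain ⟨r, hr⟩ := hpodd
      rw [← hap, hr, ← h2' r (n + 1)]
      congr 1; ring
    have h3 : ∀ n, a n = (-1) ^ n * a 0 := by
      intro n
      induction n with
      | zero => simp
      | succ n ih => rw [h1, ih, pow_succ]; ring
    refine ⟨a 0, ?_, ?_⟩
    · have := hs 0
      rw [Finset.sum_congr rfl (g := fun _ => a 0)] at this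
      · simpa using this
      · intro k _
        rw [zero_add, h3 k, ← mul_assoc, ← mul_pow]
        simp
    · ext i
      have h0 := ha 0 i
      rw [zero_add] at h0
      rw [show v i = a i from h0, h3 i]
      rfl
  · rintro ⟨a, ha, rfl⟩
    have ha : (p : ZMod m) * a = 0 := ha
    change phi2pStep p m (phi2pStep p m _) = _
    rw [phi2p_altVec p m hp hpodd a ha, phi2p_altVec p m hp hpodd (-a) (by simp [ha]), neg_neg]

lemma altVec_injective (p m : ℕ) (hp : 3 ≤ p) : Function.Injective (altVec p m) := by
  intro a b h
  simpa [altVec] using congrFun h ⟨0, by omega⟩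

lemma phi2p_fix_one (p m : ℕ) (hp : 3 ≤ p) (hpodd : Odd p) :
    {v : Fin (p - 1) → ZMod m | phi2pStep p m v = v} = {0} := by
  ext v
  simp only [Set.mem_ofPred_eq, Set.mem_singleton_iff]
  constructor
  · intro hv
    have h2 : v ∈ {v | (phi2pStep p m)^[2] v = v} := by
      change phi2pStep p m (phi2pStep p m v) = v
      rw [hv, hv]
    rw [phi2p_fix_two p m hp hpodd] at h2
    obtain ⟨a, ha, rfl⟩ := h2
    have ha : (p : ZMod m) * a = 0 := ha
    rw [phi2p_altVec p m hp hpodd a ha] at hv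
    have h3 := altVec_injective p m hp hv
    obtain ⟨r, rfl⟩ := hpodd
    push_cast at ha
    have : a = 0 := by linear_combination ha + r * h3
    ext i
    simp [altVec, this]
  · rintro rfl
    ext i
    simp [phi2pStep]

lemma phi2p_fix_p_card (p m : ℕ) (hp : 3 ≤ p) (hpodd : Odd p) (hm : 0 < m) (h2 : 2 ∣ m) :
    {v : Fin (p - 1) → ZMod m | (phi2pStep p m)^[p] v = v}.ncard = 2 ^ (p - 1) := by
  classical
  have : NeZero m := ⟨hm.ne'⟩
  have h : {v : Fin (p - 1) → ZMod m | (phi2pStep p m)^[p] v = v} =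
     ((Fintype.piFinset (fun _ : Fin (p - 1) => {a : ZMod m | ((2 : ℕ) : ZMod m) * a = 0}.toFinset) :
      Finset (Fin (p - 1) → ZMod m)) : Set (Fin (p - 1) → ZMod m)) := by
    ext v
    simp only [Set.mem_ofPred_eq, phi2p_iter_p p m hp hpodd, Finset.mem_coe, Fintype.mem_piFinset,
      Set.mem_toFinset]
    rw [funext_iff]
    refine forall_congr' fun i => ?_
    rw [Pi.neg_apply]
    push_cast
    constructor
    · intro h; linear_combination -h
    · intro h; linear_combination -h
  rw [h, Set.ncard_coe_finset, Fintype.card_piFinset_const, ← Set.ncard_eq_toFinset_card',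
    zmod_torsion_card m 2 hm h2]

/-- for an odd prime `p` and `2p ∣ m`, the number of orbits of the
Φ_{2p} state map is `(m^(p-1) - 2^(p-1) - p + 1)/(2p) + 1 + (p-1)/2 + (2^(p-1)-1)/p`;
specifically: one fixed point (the zero vector), `(p-1)/2` orbits of length 2,
`(2^(p-1)-1)/p` orbits of length `p`, and `(m^(p-1) - 2^(p-1) - p + 1)/(2p)`
orbits of length `2p`. -/
theorem phi2p_orbit_count_two_p_dvd (p m : ℕ) (hp : p.Prime) (hpodd : Odd p)
    (hm : 0 < m) (hdvd : 2 * p ∣ m) :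
    (orbitsOf (phi2pStep p m)).ncard =
      (m ^ (p - 1) - 2 ^ (p - 1) - p + 1) / (2 * p) + 1 + (p - 1) / 2
        + (2 ^ (p - 1) - 1) / p ∧
    {v : Fin (p - 1) → ZMod m | phi2pStep p m v = v} = {0} ∧
    {O ∈ orbitsOf (phi2pStep p m) | O.ncard = 2}.ncard = (p - 1) / 2 ∧
    {O ∈ orbitsOf (phi2pStep p m) | O.ncard = p}.ncard = (2 ^ (p - 1) - 1) / p ∧
    {O ∈ orbitsOf (phi2pStep p m) | O.ncard = 2 * p}.ncard =
      (m ^ (p - 1) - 2 ^ (p - 1) - p + 1) / (2 * p) := by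
  classical
  have : NeZero m := ⟨hm.ne'⟩
  have hp3 : 3 ≤ p := by
    have := hp.two_le
    obtain ⟨r, hr⟩ := hpodd
    omega
  have hp2 : p ≠ 2 := by omega
  have hper : ∀ v, Function.IsPeriodicPt (phi2pStep p m) (2 * p) v := by
    intro v
    change (phi2pStep p m)^[2 * p] v = v
    rw [two_mul, Function.iterate_add_apply, phi2p_iter_p p m hp3 hpodd,
      phi2p_iter_p p m hp3 hpodd, neg_neg]
  have hpp : ∀ v, v ∈ Function.periodicPts (phi2pStep p m) :=
    fun v => ⟨2 * p, by omega, hper v⟩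
  have hdiv : ∀ v, Function.minimalPeriod (phi2pStep p m) v = 1 ∨
      Function.minimalPeriod (phi2pStep p m) v = 2 ∨
      Function.minimalPeriod (phi2pStep p m) v = p ∨
      Function.minimalPeriod (phi2pStep p m) v = 2 * p := by
    intro v
    have h := (hper v).minimalPeriod_dvd
    obtain ⟨x, y, hx, hy, hxy⟩ := (Nat.dvd_mul).1 h
    rw [← hxy.symm.symm]
    rcases (Nat.dvd_prime Nat.prime_two).1 hx with rfl | rfl <;>
    rcases (Nat.dvd_prime hp).1 hy with rfl | rfl <;> simp
  have hfix := phi2p_fix_one p m hp3 hpodd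
  have hone : ∀ v, Function.minimalPeriod (phi2pStep p m) v = 1 ↔ v = 0 := by
    intro v
    rw [Function.minimalPeriod_eq_one_iff_isFixedPt]
    change v ∈ {v | phi2pStep p m v = v} ↔ _
    rw [hfix]; rfl
  have hprime : ∀ q, q.Prime → {v | Function.minimalPeriod (phi2pStep p m) v = q}.ncard =
      {v | (phi2pStep p m)^[q] v = v}.ncard - 1 := by
    intro q hq
    have h0 : (0 : Fin (p - 1) → ZMod m) ∈ {v | (phi2pStep p m)^[q] v = v} := by
      have : phi2pStep p m 0 = 0 := by
        change (0 : Fin (p - 1) → ZMod m) ∈ {v | phi2pStep p m v = v}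
        rw [hfix]; rfl
      exact Function.iterate_fixed this q
    rw [← Set.ncard_diff_singleton_of_mem h0]
    congr 1
    ext v
    change _ ↔ Function.IsPeriodicPt (phi2pStep p m) q v ∧ ¬ (v = 0)
    rw [Function.isPeriodicPt_iff_minimalPeriod_dvd, Nat.dvd_prime hq, ← hone]
    have := hq.one_lt
    simp only [Set.mem_ofPred_eq]
    omega
  have c2 := hprime 2 Nat.prime_two
  rw [phi2p_fix_two p m hp3 hpodd, Set.ncard_image_of_injective _ (altVec_injective p m hp3),
    zmod_torsion_card m p hm (dvd_trans (dvd_mul_left p 2) hdvd)] at c2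
  have cp := hprime p hp
  rw [phi2p_fix_p_card p m hp3 hpodd hm (dvd_trans (dvd_mul_right 2 p) hdvd)] at cp
  have c1 : {v | Function.minimalPeriod (phi2pStep p m) v = 1}.ncard = 1 := by
    have : {v | Function.minimalPeriod (phi2pStep p m) v = 1} = {0} := by
      ext v; exact hone v
    rw [this, Set.ncard_singleton]
  have hpart : ∀ {β : Type} [Finite β] (S : Set β) (g : β → ℕ),
      (∀ v ∈ S, g v = 1 ∨ g v = 2 ∨ g v = p ∨ g v = 2 * p) →
      S.ncard = {v ∈ S | g v = 1}.ncard + {v ∈ S | g v = 2}.ncard + {v ∈ S | g v = p}.ncard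
        + {v ∈ S | g v = 2 * p}.ncard := by
    intro β _ S g hg
    rw [← Set.ncard_union_eq, ← Set.ncard_union_eq, ← Set.ncard_union_eq]
    · congr 1
      ext v
      simp only [Set.mem_union, Set.mem_ofPred_eq]
      have := hg v
      tauto
    all_goals
      rw [Set.disjoint_left]
      intro v
      simp only [Set.mem_union, Set.mem_ofPred_eq]
      omega
  have ctot := hpart (Set.univ : Set (Fin (p - 1) → ZMod m))
    (Function.minimalPeriod (phi2pStep p m)) (fun v _ => hdiv v)
  simp only [Set.mem_univ, true_and] at ctot
  rw [Set.ncard_univ, Nat.card_fun, Nat.card_zmod, Nat.card_fin, c1, c2, cp] at ctot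
  have otot := hpart (orbitsOf (phi2pStep p m)) Set.ncard (by
    rintro _ ⟨v, rfl⟩
    rw [orbitOf_ncard _ _ (hpp v)]
    exact hdiv v)
  have o1 := orbits_count (phi2pStep p m) hpp 1
  have o2 := orbits_count (phi2pStep p m) hpp 2
  have op := orbits_count (phi2pStep p m) hpp p
  have o2p := orbits_count (phi2pStep p m) hpp (2 * p)
  rw [c1] at o1
  rw [c2] at o2
  rw [cp] at op
  have hpow : 1 ≤ 2 ^ (p - 1) := Nat.one_le_two_pow
  have r2 : {O ∈ orbitsOf (phi2pStep p m) | O.ncard = 2}.ncard = (p - 1) / 2 := by omega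
  have rp : {O ∈ orbitsOf (phi2pStep p m) | O.ncard = p}.ncard = (2 ^ (p - 1) - 1) / p := by
    rw [op, Nat.mul_div_cancel _ (by omega)]
  have r2p : {O ∈ orbitsOf (phi2pStep p m) | O.ncard = 2 * p}.ncard =
      (m ^ (p - 1) - 2 ^ (p - 1) - p + 1) / (2 * p) := by
    have hge : 2 ^ (p - 1) + p ≤ m ^ (p - 1) := by
      have hm2 : 2 * p ≤ m := Nat.le_of_dvd hm hdvd
      calc 2 ^ (p - 1) + p ≤ 2 ^ (p - 1) * p := by
            have : 2 ≤ 2 ^ (p - 1) := Nat.le_self_pow (by omega) 2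
            nlinarith
        _ ≤ 2 ^ (p - 1) * p ^ (p - 1) := by
            gcongr
            exact Nat.le_self_pow (by omega) p
        _ = (2 * p) ^ (p - 1) := (mul_pow _ _ _).symm
        _ ≤ m ^ (p - 1) := by gcongr
    have : m ^ (p - 1) - 2 ^ (p - 1) - p + 1 =
        {v | Function.minimalPeriod (phi2pStep p m) v = 2 * p}.ncard := by omega
    rw [this, o2p, Nat.mul_div_cancel _ (by omega)]
  refine ⟨?_, hfix, r2, rp, r2p⟩
  rw [otot, r2, rp, r2p]
  omega
end

section
/- Let p be a prime, j a positive integer, and m a positive integer with p ∤ m. Then the number of orbits of the Φ_{p^j} state map on (ℤ/mℤ)^(p^j − p^(j−1)) equals (m^(p^j − p^(j−1)) − 1)/p^j + 1, and the length of every orbit is either 1 or p^j. -/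
/-- The Φ_{p^j} state map on `(ℤ/mℤ)^(p^j - p^(j-1))`: shift left and append
`-(v_0 + v_{p^(j-1)} + v_{2p^(j-1)} + ⋯ + v_{(p-2)p^(j-1)})`, the
state-transition map of the recurrence
`a_n = -(a_{n-p^(j-1)} + a_{n-2p^(j-1)} + ⋯ + a_{n-(p-1)p^(j-1)})`
with characteristic polynomial `Φ_{p^j}(x) = ∑_{k=0}^{p-1} x^(k p^(j-1))`.
(The inner `dite` is always in its first branch when `p ≥ 2` and `j ≥ 1`.) -/
def phiPjStep (p j m : ℕ) (v : Fin (p ^ j - p ^ (j - 1)) → ZMod m) :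
    Fin (p ^ j - p ^ (j - 1)) → ZMod m :=
  fun i =>
    if h : (i : ℕ) + 1 < p ^ j - p ^ (j - 1) then v ⟨(i : ℕ) + 1, h⟩
    else -(∑ k : Fin (p - 1),
      if hk : (k : ℕ) * p ^ (j - 1) < p ^ j - p ^ (j - 1)
      then v ⟨(k : ℕ) * p ^ (j - 1), hk⟩ else 0)

open Function in
theorem mem_orbitOf_iff_eq {α : Type*} (f : α → α) (P : ℕ) (hP : 0 < P)
    (hf : ∀ v, f^[P] v = v) (v w : α) : orbitOf f w = orbitOf f v ↔ w ∈ orbitOf f v := by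
  have sub : ∀ v w, w ∈ orbitOf f v → orbitOf f w ⊆ orbitOf f v := by
    rintro v w ⟨k, rfl⟩ x ⟨l, rfl⟩
    exact ⟨l + k, by rw [iterate_add_apply]⟩
  have symm' : ∀ v w, w ∈ orbitOf f v → v ∈ orbitOf f w := by
    rintro v w ⟨k, rfl⟩
    refine ⟨P * k - k, ?_⟩
    rw [← iterate_add_apply, Nat.sub_add_cancel (Nat.le_mul_of_pos_left k hP)]
    have : IsPeriodicPt f P v := hf v
    exact this.mul_const k
  constructor
  · intro h
    rw [← h]; exact ⟨0, rfl⟩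
  · intro h
    exact (sub _ _ h).antisymm (sub _ _ (symm' _ _ h))

open Function in
theorem ncard_orbitOf {α : Type*} (f : α → α) (v : α) (h : 0 < minimalPeriod f v) :
    (orbitOf f v).ncard = minimalPeriod f v := by
  have : orbitOf f v = (fun k => f^[k] v) '' (Finset.range (minimalPeriod f v) : Set ℕ) := by
    ext w
    constructor
    · rintro ⟨k, rfl⟩
      exact ⟨k % minimalPeriod f v, by simpa using Nat.mod_lt _ h, iterate_mod_minimalPeriod_eq⟩
    · rintro ⟨k, -, rfl⟩
      exact ⟨k, rfl⟩
  rw [this, Set.ncard_image_of_injOn, Set.ncard_coe_finset, Finset.card_range]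
  simpa using (iterate_injOn_Iio_minimalPeriod (f := f) (x := v))

open Function in
theorem orbit_count_abstract {α : Type*} [Fintype α] (f : α → α) (P : ℕ) (hP : 0 < P)
    (hf : ∀ v, f^[P] v = v) (z : α) (hz : f z = z)
    (hmin : ∀ v, v ≠ z → minimalPeriod f v = P) :
    (orbitsOf f).ncard = (Fintype.card α - 1) / P + 1 ∧
    (∀ O ∈ orbitsOf f, O.ncard = 1 ∨ O.ncard = P) := by
  classical
  have hzo : (orbitOf f z).ncard = 1 := by
    have : minimalPeriod f z = 1 := minimalPeriod_eq_one_iff_isFixedPt.2 hz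
    rw [ncard_orbitOf _ _ (by omega), this]
  have hvo : ∀ v, v ≠ z → (orbitOf f v).ncard = P := by
    intro v hv
    rw [ncard_orbitOf _ _ (by rw [hmin v hv]; exact hP), hmin v hv]
  refine ⟨?_, ?_⟩
  · have h1 := Finset.card_eq_sum_card_image (orbitOf f) (Finset.univ : Finset α)
    have hfib : ∀ v, (Finset.univ.filter (fun w => orbitOf f w = orbitOf f v)).card
        = (orbitOf f v).ncard := by
      intro v
      rw [← Set.ncard_coe_finset]
      congr 1
      ext w
      simp [mem_orbitOf_iff_eq f P hP hf]
    have hmem : orbitOf f z ∈ Finset.univ.image (orbitOf f) := by simp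
    rw [← Finset.add_sum_erase _ _ hmem, hfib, hzo] at h1
    have h2 : ∀ O ∈ (Finset.univ.image (orbitOf f)).erase (orbitOf f z),
        (Finset.univ.filter (fun w => orbitOf f w = O)).card = P := by
      intro O hO
      simp only [Finset.mem_erase, Finset.mem_image, Finset.mem_univ, true_and] at hO
      obtain ⟨hne, v, rfl⟩ := hO
      rw [hfib]
      exact hvo v (fun h => hne (by rw [h]))
    rw [Finset.sum_congr rfl h2, Finset.sum_const, Finset.card_erase_of_mem hmem, smul_eq_mul,
      Finset.card_univ] at h1
    have h3 : (orbitsOf f).ncard = (Finset.univ.image (orbitOf f)).card := by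
      rw [← Set.ncard_coe_finset]
      simp [orbitsOf]
    have h4 : 0 < (Finset.univ.image (orbitOf f)).card := Finset.card_pos.2 ⟨_, hmem⟩
    rw [h3, h1, Nat.add_sub_cancel_left, Nat.mul_div_cancel _ hP]
    omega
  · rintro O ⟨v, rfl⟩
    by_cases hv : v = z
    · left; rw [hv, hzo]
    · right; exact hvo v hv

open Function in
theorem phiPj_key (p j m : ℕ) (hp : p.Prime) (hj : 1 ≤ j) (v : Fin (p ^ j - p ^ (j - 1)) → ZMod m) :
    ∃ a : ℕ → ZMod m, (∀ n (i : Fin (p ^ j - p ^ (j - 1))),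
      ((phiPjStep p j m)^[n] v) i = a (n + i)) ∧
      ∀ n, ∑ k ∈ Finset.range p, a (n + k * p ^ (j - 1)) = 0 := by
  obtain ⟨r, rfl⟩ : ∃ r, p = r + 2 := ⟨p - 2, by have := hp.two_le; omega⟩
  obtain ⟨l, rfl⟩ : ∃ l, j = l + 1 := ⟨j - 1, by omega⟩
  have hq : 0 < (r + 2) ^ l := by positivity
  have hN : (r + 2) ^ (l + 1) - (r + 2) ^ (l + 1 - 1) = (r + 1) * (r + 2) ^ l := by
    rw [Nat.add_sub_cancel, pow_succ, Nat.sub_eq_iff_eq_add (by nlinarith)]; ring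
  have hN0 : 0 < (r + 2) ^ (l + 1) - (r + 2) ^ (l + 1 - 1) := by rw [hN]; positivity
  have hA : ∀ i n (hi : i < (r + 2) ^ (l + 1) - (r + 2) ^ (l + 1 - 1)),
      ((phiPjStep (r+2) (l+1) m)^[n] v) ⟨i, hi⟩ =
        ((phiPjStep (r+2) (l+1) m)^[n + i] v) ⟨0, hN0⟩ := by
    intro i
    induction i with
    | zero => intro n hi; rfl
    | succ i ih =>
      intro n hi
      have := ih (n + 1) (by omega)
      rw [show n + (i + 1) = n + 1 + i by ring, ← this, iterate_succ_apply']
      simp only [phiPjStep]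
      rw [dif_pos hi]
  refine ⟨fun n => ((phiPjStep (r+2) (l+1) m)^[n] v) ⟨0, hN0⟩, fun n i => hA i n i.2, ?_⟩
  intro n
  rw [Finset.sum_range_succ]
  have hlast := hA ((r + 2) ^ (l + 1) - (r + 2) ^ (l + 1 - 1) - 1) (n + 1) (by omega)
  rw [iterate_succ_apply'] at hlast
  rw [show n + 1 + ((r + 2) ^ (l + 1) - (r + 2) ^ (l + 1 - 1) - 1) =
    n + (r + 1) * (r + 2) ^ (l + 1 - 1) by
      rw [Nat.add_sub_cancel] at *; omega] at hlast
  beta_reduce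
  rw [← hlast, phiPjStep, dif_neg (by simp only; omega), ← sub_eq_add_neg, sub_eq_zero,
    Finset.sum_range]
  refine Finset.sum_congr rfl fun k _ => ?_
  have hk : (k : ℕ) * (r + 2) ^ (l + 1 - 1) < (r + 2) ^ (l + 1) - (r + 2) ^ (l + 1 - 1) := by
    rw [hN, Nat.add_sub_cancel]
    exact Nat.mul_lt_mul_of_pos_right k.2 hq
  rw [dif_pos hk]
  exact (hA _ n hk).symm

/-- for a prime `p`, `j ≥ 1` and `p ∤ m`, the number of orbits of
the Φ_{p^j} state map is `(m^(p^j - p^(j-1)) - 1)/p^j + 1`, and every orbit has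
length `1` or `p^j`. -/
theorem phiPj_orbit_count_of_not_dvd (p j m : ℕ) (hp : p.Prime) (hj : 1 ≤ j)
    (hm : 0 < m) (hndvd : ¬ p ∣ m) :
    (orbitsOf (phiPjStep p j m)).ncard = (m ^ (p ^ j - p ^ (j - 1)) - 1) / p ^ j + 1 ∧
    (∀ O ∈ orbitsOf (phiPjStep p j m), O.ncard = 1 ∨ O.ncard = p ^ j) := by
  haveI : NeZero m := ⟨hm.ne'⟩
  have hper : ∀ v, (phiPjStep p j m)^[p ^ j] v = v := by
    intro v
    obtain ⟨a, ha, hs⟩ := phiPj_key p j m hp hj v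
    funext i
    have h0 := ha 0 i
    rw [Function.iterate_zero, id] at h0
    rw [ha, h0]
    have e1 := hs (0 + i)
    have e2 := hs (0 + i + p ^ (j - 1))
    obtain ⟨r, rfl⟩ : ∃ r, p = r + 1 := ⟨p - 1, by have := hp.two_le; omega⟩
    rw [Finset.sum_range_succ'] at e1
    rw [Finset.sum_range_succ] at e2
    have e3 : ∑ k ∈ Finset.range r, a (0 + i + (r + 1) ^ (j - 1) + k * (r + 1) ^ (j - 1)) =
        ∑ k ∈ Finset.range r, a (0 + i + (k + 1) * (r + 1) ^ (j - 1)) :=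
      Finset.sum_congr rfl fun k _ => by congr 1; ring
    have e4 : (r + 1) ^ j + (i : ℕ) = 0 + i + (r + 1) ^ (j - 1) + r * (r + 1) ^ (j - 1) := by
      obtain ⟨l, rfl⟩ : ∃ l, j = l + 1 := ⟨j - 1, by omega⟩
      generalize (i : ℕ) = x
      rw [Nat.add_sub_cancel]; ring
    rw [e4]
    rw [e3] at e2
    rw [Nat.zero_mul] at e1
    exact add_left_cancel (e2.trans e1.symm)
  have hfix : ∀ v, (phiPjStep p j m)^[p ^ (j - 1)] v = v → v = 0 := by
    intro v hv
    obtain ⟨a, ha, hs⟩ := phiPj_key p j m hp hj v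
    funext i
    have h0 : ∀ k, a (0 + i + k * p ^ (j - 1)) = v i := by
      intro k
      have hk : (phiPjStep p j m)^[p ^ (j - 1) * k] v = v :=
        Function.IsPeriodicPt.mul_const (show Function.IsPeriodicPt _ _ _ from hv) k
      rw [← congrFun hk i, ha]
      congr 1; ring
    have e1 := hs (0 + i)
    simp only [h0, Finset.sum_const, Finset.card_range, nsmul_eq_mul] at e1
    have hu : IsUnit (p : ZMod m) :=
      (ZMod.isUnit_iff_coprime p m).2 ((Nat.Prime.coprime_iff_not_dvd hp).2 hndvd)
    exact (hu.mul_right_eq_zero).1 e1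
  have hz : phiPjStep p j m 0 = 0 := by
    funext i
    simp [phiPjStep]
  have := orbit_count_abstract (phiPjStep p j m) (p ^ j) (pow_pos hp.pos j) hper 0 hz (by
    intro v hv
    have hd : Function.minimalPeriod (phiPjStep p j m) v ∣ p ^ j :=
      Function.IsPeriodicPt.minimalPeriod_dvd (hper v)
    obtain ⟨k, hk, he⟩ := (Nat.dvd_prime_pow hp).1 hd
    rcases hk.eq_or_lt with rfl | hlt
    · exact he
    · refine absurd (hfix v ?_) hv
      have : Function.minimalPeriod (phiPjStep p j m) v ∣ p ^ (j - 1) := by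
        rw [he]; exact pow_dvd_pow p (by omega)
      exact (Function.isPeriodicPt_minimalPeriod _ v).trans_dvd this)
  simpa [ZMod.card] using this
end

section
/- Let p be a prime, j a positive integer, and m a positive integer with p ∣ m. Then the number of orbits of the Φ_{p^j} state map on (ℤ/mℤ)^(p^j − p^(j−1)) equals (m^(p^j − p^(j−1)) − Σ_{i=0}^{j−1} p^i · M(p, p^i))/p^j + Σ_{i=0}^{j−1} M(p, p^i), and the length of every orbit is p^i for some i with 0 ≤ i ≤ j. -/
/-- Moreau's necklace-counting function
`M(m, r) = (1/r) ∑_{d ∣ r} μ(d) m^(r/d)`, the number of aperiodic `m`-ary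
necklaces of length `r` (`μ` is the Möbius function). -/
def necklaceM (m r : ℕ) : ℕ :=
  ((∑ d ∈ r.divisors, (ArithmeticFunction.moebius d) * (m : ℤ) ^ (r / d)) / (r : ℤ)).toNat

section OrbitLemmas

open Function

lemma aux_orbit_eq {α : Type*} (f : α → α) (n : ℕ) (hn : 0 < n) (hf : f^[n] = id) (v w : α)
    (h : w ∈ orbitOf f v) : orbitOf f w = orbitOf f v := by
  obtain ⟨k, rfl⟩ := h
  ext x
  constructor
  · rintro ⟨l, rfl⟩
    exact ⟨l + k, iterate_add_apply f l k v⟩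
  · rintro ⟨l, rfl⟩
    refine ⟨l + (n - 1) * k, ?_⟩
    rw [← iterate_add_apply]
    have h1 : l + (n - 1) * k + k = l + n * k := by
      obtain ⟨n', rfl⟩ : ∃ n', n = n' + 1 := ⟨n - 1, by omega⟩
      simp only [Nat.add_sub_cancel]
      ring
    rw [h1, iterate_add_apply, iterate_mul, hf]
    simp

lemma aux_orbit_card {α : Type*} (f : α → α) (n : ℕ) (hn : 0 < n) (hf : f^[n] = id) (v : α) :
    (orbitOf f v).ncard = minimalPeriod f v := by
  have hv : IsPeriodicPt f n v := by
    show f^[n] v = v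
    rw [hf]; rfl
  have hpos := hv.minimalPeriod_pos hn
  have h1 : orbitOf f v = (fun k => f^[k] v) '' (Set.Iio (minimalPeriod f v)) := by
    ext x
    constructor
    · rintro ⟨l, rfl⟩
      exact ⟨l % minimalPeriod f v, Nat.mod_lt _ hpos, iterate_mod_minimalPeriod_eq⟩
    · rintro ⟨l, -, rfl⟩
      exact ⟨l, rfl⟩
  rw [h1, Set.ncard_image_of_injOn iterate_injOn_Iio_minimalPeriod]
  rw [← Finset.coe_Iio, Set.ncard_coe_finset, Nat.card_Iio]

open Classical in
lemma aux_count_s8 {α : Type*} [Fintype α] (f : α → α) (p j : ℕ) (hp : p.Prime)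
    (hf : f^[p ^ j] = id) :
    ∃ t : ℕ → ℕ, (orbitsOf f).ncard = ∑ i ∈ Finset.range (j + 1), t i ∧
      ∀ i, Nat.card {v // minimalPeriod f v = p ^ i} = p ^ i * t i := by
  have hn : 0 < p ^ j := pow_pos hp.pos _
  refine ⟨fun i => ((Finset.univ.filter fun v => minimalPeriod f v = p ^ i).image
    (orbitOf f)).card, ?_, ?_⟩
  · have h0 : orbitsOf f = ((Finset.univ.image (orbitOf f) : Finset (Set α)) : Set (Set α)) := by
      simp [orbitsOf]
    rw [h0, Set.ncard_coe_finset,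
      Finset.card_eq_sum_card_fiberwise (f := fun O : Set α => Nat.log p O.ncard)
        (t := Finset.range (j + 1))]
    · refine Finset.sum_congr rfl fun i hi => ?_
      congr 1
      ext O
      simp only [Finset.mem_filter, Finset.mem_image, Finset.mem_univ, true_and]
      constructor
      · rintro ⟨⟨v, rfl⟩, h⟩
        refine ⟨v, ?_, rfl⟩
        rw [aux_orbit_card f _ hn hf] at h
        have hv : IsPeriodicPt f (p ^ j) v := by
          show f^[p ^ j] v = v
          rw [hf]; rfl
        obtain ⟨k, hk, hk'⟩ := (Nat.dvd_prime_pow hp).1 hv.minimalPeriod_dvd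
        rw [hk', Nat.log_pow hp.one_lt] at h
        rw [hk', h]
      · rintro ⟨v, h, rfl⟩
        refine ⟨⟨v, rfl⟩, ?_⟩
        rw [aux_orbit_card f _ hn hf, h, Nat.log_pow hp.one_lt]
    · intro O hO
      simp only [Finset.coe_image, Finset.coe_univ, Set.image_univ, Set.mem_range] at hO
      obtain ⟨v, rfl⟩ := hO
      have hv : IsPeriodicPt f (p ^ j) v := by
        show f^[p ^ j] v = v
        rw [hf]; rfl
      obtain ⟨k, hk, hk'⟩ := (Nat.dvd_prime_pow hp).1 hv.minimalPeriod_dvd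
      simp only [aux_orbit_card f _ hn hf, hk', Nat.log_pow hp.one_lt, Finset.coe_range,
        Set.mem_Iio]
      omega
  · intro i
    rw [Nat.card_eq_fintype_card, Fintype.card_subtype, Finset.card_eq_sum_card_image (orbitOf f), Finset.sum_const_nat (m := p ^ i), mul_comm]
    intro O hO
    simp only [Finset.mem_image, Finset.mem_filter, Finset.mem_univ, true_and] at hO
    obtain ⟨v, hv, rfl⟩ := hO
    rw [← hv, ← aux_orbit_card f _ hn hf, ← Set.ncard_coe_finset]
    congr 1
    ext w
    simp only [Finset.coe_filter, Finset.mem_filter, Finset.mem_univ, true_and, Set.mem_ofPred_eq]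
    constructor
    · rintro ⟨-, h⟩
      rw [← h]
      exact ⟨0, rfl⟩
    · intro h
      have := aux_orbit_eq f _ hn hf v w h
      refine ⟨?_, this⟩
      rw [← aux_orbit_card f _ hn hf w, this]

open Classical in
lemma aux_count_zero {α : Type*} [Fintype α] (f : α → α) (p : ℕ) :
    Nat.card {v // minimalPeriod f v = p ^ 0} =
      Nat.card {v // f^[p ^ 0] v = v} := by
  simp only [Nat.card_eq_fintype_card, Fintype.card_subtype]
  congr 1
  ext v
  simp [minimalPeriod_eq_one_iff_isFixedPt, IsFixedPt]

open Classical in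
lemma aux_count_succ {α : Type*} [Fintype α] (f : α → α) (p i : ℕ) (hp : p.Prime) :
    Nat.card {v // minimalPeriod f v = p ^ (i + 1)} +
      Nat.card {v // f^[p ^ i] v = v} =
      Nat.card {v // f^[p ^ (i + 1)] v = v} := by
  simp only [Nat.card_eq_fintype_card, Fintype.card_subtype]
  rw [← Finset.card_union_of_disjoint]
  · congr 1
    ext v
    have key : ∀ n, f^[n] v = v ↔ minimalPeriod f v ∣ n := fun n =>
      isPeriodicPt_iff_minimalPeriod_dvd
    simp only [Finset.mem_union, Finset.mem_filter, Finset.mem_univ, true_and, key]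
    constructor
    · rintro (h | h)
      · rw [h]
      · exact h.trans (pow_dvd_pow _ (Nat.le_succ _))
    · intro h
      obtain ⟨k, hk, hk'⟩ := (Nat.dvd_prime_pow hp).1 h
      rcases Nat.lt_or_ge k (i + 1) with h1 | h1
      · right
        rw [hk']
        exact pow_dvd_pow _ (by omega)
      · left
        rw [hk']
        congr 1
        omega
  · rw [Finset.disjoint_filter]
    intro v _ h h'
    have : minimalPeriod f v ∣ p ^ i := IsPeriodicPt.minimalPeriod_dvd h'
    rw [h, Nat.pow_dvd_pow_iff_le_right hp.one_lt] at this
    omega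

end OrbitLemmas

section Necklace

lemma aux_necklace_zero (p : ℕ) : p ^ 0 * necklaceM p (p ^ 0) = p ^ (p ^ 0) := by
  simp [necklaceM]

lemma aux_necklace_succ (p i : ℕ) (hp : p.Prime) :
    p ^ (i + 1) * necklaceM p (p ^ (i + 1)) + p ^ (p ^ i) = p ^ (p ^ (i + 1)) := by
  have hle : p ^ (p ^ i) ≤ p ^ (p ^ (i + 1)) :=
    Nat.pow_le_pow_right hp.pos (Nat.pow_le_pow_right hp.pos (Nat.le_succ _))
  have hi : i + 1 ≤ p ^ i := Nat.lt_pow_self hp.one_lt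
  have hdvd : p ^ (i + 1) ∣ p ^ (p ^ (i + 1)) - p ^ (p ^ i) :=
    Nat.dvd_sub (pow_dvd_pow _ (hi.trans (Nat.pow_le_pow_right hp.pos (Nat.le_succ _))))
      (pow_dvd_pow _ hi)
  have hs : (∑ d ∈ (p ^ (i + 1)).divisors,
      (ArithmeticFunction.moebius d) * (p : ℤ) ^ (p ^ (i + 1) / d)) =
      ((p ^ (p ^ (i + 1)) - p ^ (p ^ i) : ℕ) : ℤ) := by
    rw [Nat.sum_divisors_prime_pow hp, Finset.sum_range_succ', Finset.sum_range_succ',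
      Finset.sum_eq_zero]
    · rw [Nat.cast_sub hle]
      have : p ^ (i + 1) / p = p ^ i := by
        rw [pow_succ, Nat.mul_div_cancel _ hp.pos]
      simp [ArithmeticFunction.moebius_apply_prime hp, this]
      ring
    · intro k _
      rw [ArithmeticFunction.moebius_apply_prime_pow hp (by omega)]
      simp
  obtain ⟨c, hc⟩ := hdvd
  have : necklaceM p (p ^ (i + 1)) = c := by
    unfold necklaceM
    rw [hs, hc]
    have h0 : ((p ^ (i + 1) : ℕ) : ℤ) ≠ 0 := by
      exact_mod_cast (pow_pos hp.pos _).ne'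
    rw [Nat.cast_mul, Int.mul_ediv_cancel_left _ h0]
    simp
  rw [this, ← hc]
  omega

end Necklace

section Recurrence

lemma aux_dim (p j : ℕ) (hp : p.Prime) (hj : 1 ≤ j) :
    p ^ j - p ^ (j - 1) = (p - 1) * p ^ (j - 1) := by
  obtain ⟨i, rfl⟩ : ∃ i, j = i + 1 := ⟨j - 1, by omega⟩
  simp only [Nat.add_sub_cancel]
  rw [Nat.sub_mul, pow_succ, one_mul, mul_comm]

/-- Sequences satisfying the recurrence. -/
def auxRec (p j m : ℕ) (s : ℕ → ZMod m) : Prop :=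
  ∀ n, ∑ k ∈ Finset.range p, s (n + k * p ^ (j - 1)) = 0

lemma aux_last (p j m : ℕ) (hp : p.Prime) (hj : 1 ≤ j)
    (v : Fin (p ^ j - p ^ (j - 1)) → ZMod m) (s : ℕ → ZMod m) (n : ℕ)
    (hv : ∀ a, v a = s (n + a)) :
    (∑ k : Fin (p - 1),
      if hk : (k : ℕ) * p ^ (j - 1) < p ^ j - p ^ (j - 1)
      then v ⟨(k : ℕ) * p ^ (j - 1), hk⟩ else 0) =
    ∑ k ∈ Finset.range (p - 1), s (n + k * p ^ (j - 1)) := by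
  rw [Finset.sum_range]
  refine Finset.sum_congr rfl fun k _ => ?_
  have : (k : ℕ) * p ^ (j - 1) < p ^ j - p ^ (j - 1) := by
    rw [aux_dim p j hp hj]
    exact Nat.mul_lt_mul_of_pos_right k.2 (pow_pos hp.pos _)
  rw [dif_pos this, hv]

lemma aux_rec_last (p j m : ℕ) (hp : p.Prime) (hj : 1 ≤ j) (s : ℕ → ZMod m) (n : ℕ) :
    ∑ k ∈ Finset.range p, s (n + k * p ^ (j - 1)) =
    ∑ k ∈ Finset.range (p - 1), s (n + k * p ^ (j - 1)) + s (n + (p ^ j - p ^ (j - 1))) := by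
  rw [aux_dim p j hp hj, ← Finset.sum_range_succ (fun k => s (n + k * p ^ (j - 1))),
    Nat.sub_add_cancel hp.one_le]

lemma aux_step (p j m : ℕ) (hp : p.Prime) (hj : 1 ≤ j) (s : ℕ → ZMod m)
    (hs : auxRec p j m s) (n : ℕ) :
    (phiPjStep p j m)^[n] (fun a : Fin (p ^ j - p ^ (j - 1)) => s (a : ℕ)) = fun a : Fin (p ^ j - p ^ (j - 1)) => s (n + (a : ℕ)) := by
  induction n with
  | zero => simp
  | succ n ih =>
    rw [Function.iterate_succ_apply', ih]
    funext a
    unfold phiPjStep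
    split_ifs with h
    · show s (n + ((a : ℕ) + 1)) = s (n + 1 + (a : ℕ))
      rw [show n + ((a : ℕ) + 1) = n + 1 + (a : ℕ) by ring]
    · rw [aux_last p j m hp hj _ s n (fun _ => rfl)]
      have h1 := hs n
      rw [aux_rec_last p j m hp hj] at h1
      have h2 : n + 1 + (a : ℕ) = n + (p ^ j - p ^ (j - 1)) := by
        have := a.2
        omega
      rw [h2]
      exact neg_eq_of_add_eq_zero_right h1

lemma aux_seq (p j m : ℕ) (hp : p.Prime) (hj : 1 ≤ j)
    (v : Fin (p ^ j - p ^ (j - 1)) → ZMod m) :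
    ∃ s : ℕ → ZMod m, auxRec p j m s ∧ v = fun a : Fin (p ^ j - p ^ (j - 1)) => s (a : ℕ) := by
  have hN : 0 < p ^ j - p ^ (j - 1) := by
    rw [aux_dim p j hp hj]
    exact Nat.mul_pos (Nat.sub_pos_of_lt hp.one_lt) (pow_pos hp.pos _)
  set s : ℕ → ZMod m := fun n => ((phiPjStep p j m)^[n] v) ⟨0, hN⟩ with hsdef
  have key : ∀ a (ha : a < p ^ j - p ^ (j - 1)) n,
      ((phiPjStep p j m)^[n] v) ⟨a, ha⟩ = s (n + a) := by
    intro a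
    induction a with
    | zero => intro ha n; rfl
    | succ a ih =>
      intro ha n
      have h1 := ih (by omega) (n + 1)
      rw [Function.iterate_succ_apply'] at h1
      rw [show n + (a + 1) = n + 1 + a by ring, ← h1]
      conv_rhs => unfold phiPjStep
      rw [dif_pos ha]
      rfl
  refine ⟨s, ?_, ?_⟩
  · intro n
    rw [aux_rec_last p j m hp hj]
    have h1 := key (p ^ j - p ^ (j - 1) - 1) (by omega) (n + 1)
    rw [Function.iterate_succ_apply'] at h1
    generalize hw : (phiPjStep p j m)^[n] v = w at h1
    unfold phiPjStep at h1
    rw [dif_neg (by simp only; omega), aux_last p j m hp hj w s n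
      (fun a => by rw [← hw]; exact key a a.2 n)] at h1
    rw [show n + 1 + (p ^ j - p ^ (j - 1) - 1) = n + (p ^ j - p ^ (j - 1)) by omega] at h1
    rw [← h1]
    simp
  · funext a
    have := key a a.2 0
    simpa using this

lemma aux_period (p j m : ℕ) (hp : p.Prime) (hj : 1 ≤ j) :
    (phiPjStep p j m)^[p ^ j] = id := by
  funext v
  obtain ⟨s, hs, rfl⟩ := aux_seq p j m hp hj v
  rw [aux_step p j m hp hj s hs]
  funext a
  have h1 := hs a
  have h2 := hs (a + p ^ (j - 1))
  obtain ⟨r, rfl⟩ : ∃ r, p = r + 1 := ⟨p - 1, by have := hp.pos; omega⟩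
  rw [Finset.sum_range_succ'] at h1
  rw [Finset.sum_range_succ] at h2
  have h3 : ∀ k, (a : ℕ) + (r + 1) ^ (j - 1) + k * (r + 1) ^ (j - 1) =
      a + (k + 1) * (r + 1) ^ (j - 1) := fun k => by ring
  simp only [h3] at h2
  have h4 := h2.trans h1.symm
  have h5 : (r + 1) * (r + 1) ^ (j - 1) = (r + 1) ^ j := by
    rw [← pow_succ', Nat.sub_add_cancel hj]
  have h6 := add_left_cancel h4
  rw [h5] at h6
  simpa [add_comm] using h6

lemma aux_torsion (p m : ℕ) (hp : p.Prime) (hm : 0 < m) (hdvd : p ∣ m) :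
    Nat.card {x : ZMod m // (p : ZMod m) * x = 0} = p := by
  have : NeZero m := ⟨hm.ne'⟩
  have h := IsAddCyclic.card_nsmulAddMonoidHom_ker (G := ZMod m) p
  rw [Nat.card_zmod, Nat.gcd_eq_right hdvd] at h
  refine Eq.trans ?_ h
  refine Nat.card_congr (Equiv.subtypeEquivRight fun x => ?_)
  simp [AddMonoidHom.mem_ker, nsmul_eq_mul]

lemma aux_fixed (p j m i : ℕ) (hp : p.Prime) (hj : 1 ≤ j) (hm : 0 < m) (hdvd : p ∣ m)
    (hi : i < j) :
    Nat.card {v : Fin (p ^ j - p ^ (j - 1)) → ZMod m // (phiPjStep p j m)^[p ^ i] v = v} =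
      p ^ (p ^ i) := by
  have : NeZero m := ⟨hm.ne'⟩
  have hq : p ^ i ∣ p ^ (j - 1) := pow_dvd_pow _ (by omega)
  have hpos : 0 < p ^ i := pow_pos hp.pos _
  have hle : p ^ i ≤ p ^ j - p ^ (j - 1) := by
    rw [aux_dim p j hp hj]
    refine (Nat.le_of_dvd (pow_pos hp.pos _) hq).trans (Nat.le_mul_of_pos_left _ ?_)
    exact Nat.sub_pos_of_lt hp.one_lt
  have hdim : p ^ i ∣ p ^ j - p ^ (j - 1) := by
    rw [aux_dim p j hp hj]
    exact hq.mul_left _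
  -- sequences attached to fixed points are periodic
  have hper : ∀ s : ℕ → ZMod m, auxRec p j m s →
      (phiPjStep p j m)^[p ^ i] (fun a : Fin (p ^ j - p ^ (j - 1)) => s (a : ℕ)) = (fun a : Fin (p ^ j - p ^ (j - 1)) => s (a : ℕ)) →
      ∀ n, s (n + p ^ i) = s n := by
    intro s hs h n
    have h1 : (phiPjStep p j m)^[n + p ^ i] (fun a : Fin (p ^ j - p ^ (j - 1)) => s (a : ℕ)) =
        (phiPjStep p j m)^[n] (fun a : Fin (p ^ j - p ^ (j - 1)) => s (a : ℕ)) := by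
      rw [Function.iterate_add_apply, h]
    rw [aux_step p j m hp hj s hs, aux_step p j m hp hj s hs] at h1
    have h2 := congrFun h1 ⟨0, by omega⟩
    simpa using h2
  have hmul : ∀ s : ℕ → ZMod m, (∀ n, s (n + p ^ i) = s n) → ∀ k n, s (n + k * p ^ i) = s n := by
    intro s h k
    induction k with
    | zero => simp
    | succ k ih =>
      intro n
      rw [add_mul, one_mul, ← add_assoc, h, ih]
  have hsum : ∀ s : ℕ → ZMod m, (∀ n, s (n + p ^ i) = s n) → ∀ n,
      ∑ k ∈ Finset.range p, s (n + k * p ^ (j - 1)) = p * s n := by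
    intro s h n
    obtain ⟨c, hc⟩ := hq
    rw [Finset.sum_congr rfl (g := fun _ => s n)]
    · simp
    · intro k _
      rw [hc, mul_comm (p ^ i), ← mul_assoc]
      exact hmul s h _ _
  have hmod : ∀ s : ℕ → ZMod m, (∀ n, s (n + p ^ i) = s n) → ∀ n, s n = s (n % p ^ i) := by
    intro s h n
    conv_lhs => rw [← Nat.mod_add_div n (p ^ i), mul_comm]
    exact hmul s h _ _
  have e : {v : Fin (p ^ j - p ^ (j - 1)) → ZMod m // (phiPjStep p j m)^[p ^ i] v = v} ≃
      (Fin (p ^ i) → {x : ZMod m // (p : ZMod m) * x = 0}) := by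
    refine Equiv.ofBijective (fun v b => ⟨v.1 ⟨b, by have := b.2; omega⟩, ?_⟩) ⟨?_, ?_⟩
    · obtain ⟨v, hv⟩ := v
      obtain ⟨s, hs, rfl⟩ := aux_seq p j m hp hj v
      have := hsum s (hper s hs hv) b
      rw [hs] at this
      exact this.symm
    · rintro ⟨v, hv⟩ ⟨w, hw⟩ hvw
      obtain ⟨s, hs, rfl⟩ := aux_seq p j m hp hj v
      obtain ⟨t, ht, rfl⟩ := aux_seq p j m hp hj w
      have hst : ∀ b, b < p ^ i → s b = t b := by
        intro b hb
        have := congrFun hvw ⟨b, hb⟩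
        simpa using this
      apply Subtype.ext
      funext a
      show s a = t a
      rw [hmod s (hper s hs hv), hmod t (hper t ht hw)]
      exact hst _ (Nat.mod_lt _ hpos)
    · intro g
      set s : ℕ → ZMod m := fun n => (g ⟨n % p ^ i, Nat.mod_lt _ hpos⟩).1 with hsdef
      have hs1 : ∀ n, s (n + p ^ i) = s n := by
        intro n
        simp [hsdef]
      have hs : auxRec p j m s := by
        intro n
        rw [hsum s hs1]
        exact (g _).2
      refine ⟨⟨fun a : Fin (p ^ j - p ^ (j - 1)) => s (a : ℕ), ?_⟩, ?_⟩
      · rw [aux_step p j m hp hj s hs]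
        funext a
        rw [add_comm]
        exact hs1 a
      · funext b
        apply Subtype.ext
        show s b = (g b).1
        simp only [hsdef, Nat.mod_eq_of_lt b.2]
  rw [Nat.card_congr e, Nat.card_fun, aux_torsion p m hp hm hdvd]
  simp

end Recurrence

/-- for a prime `p`, `j ≥ 1` and `p ∣ m`, the number of orbits of
the Φ_{p^j} state map is
`(m^(p^j - p^(j-1)) - ∑_{i=0}^{j-1} p^i M(p, p^i))/p^j + ∑_{i=0}^{j-1} M(p, p^i)`,
and every orbit has length `p^i` for some `0 ≤ i ≤ j`. -/
theorem phiPj_orbit_count_of_dvd (p j m : ℕ) (hp : p.Prime) (hj : 1 ≤ j)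
    (hm : 0 < m) (hdvd : p ∣ m) :
    (orbitsOf (phiPjStep p j m)).ncard =
      (m ^ (p ^ j - p ^ (j - 1)) - ∑ i ∈ Finset.range j, p ^ i * necklaceM p (p ^ i)) / p ^ j
        + ∑ i ∈ Finset.range j, necklaceM p (p ^ i) ∧
    (∀ O ∈ orbitsOf (phiPjStep p j m), ∃ i ≤ j, O.ncard = p ^ i) := by
  have : NeZero m := ⟨hm.ne'⟩
  have hf := aux_period p j m hp hj
  have hn : 0 < p ^ j := pow_pos hp.pos _
  constructor
  · obtain ⟨t, ht, hc⟩ := aux_count_s8 (phiPjStep p j m) p j hp hf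
    have hF : ∀ i, i < j →
        Nat.card {v // (phiPjStep p j m)^[p ^ i] v = v} = p ^ (p ^ i) := by
      intro i hi
      exact aux_fixed p j m i hp hj hm hdvd hi
    have htM : ∀ i, i < j → t i = necklaceM p (p ^ i) := by
      intro i hi
      have h1 := hc i
      apply Nat.eq_of_mul_eq_mul_left (pow_pos hp.pos i)
      cases i with
      | zero => rw [← h1, aux_necklace_zero, ← hF 0 hi]; exact aux_count_zero _ p
      | succ i =>
        have h2 := aux_count_succ (phiPjStep p j m) p i hp
        have h3 := aux_necklace_succ p i hp
        have h4 := hF i (by omega)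
        have h5 := hF (i + 1) hi
        rw [← h1]
        have h6 := h2
        rw [h4, h5] at h6
        omega
    have htotal : ∀ i, (∑ l ∈ Finset.range (i + 1), p ^ l * t l) =
        Nat.card {v // (phiPjStep p j m)^[p ^ i] v = v} := by
      intro i
      induction i with
      | zero => rw [Finset.sum_range_one, ← hc 0]; exact aux_count_zero _ p
      | succ i ih =>
        rw [Finset.sum_range_succ, ih, ← hc (i + 1), add_comm]
        exact aux_count_succ _ p i hp
    have hj' := htotal j
    rw [hf] at hj'
    have hcard : Nat.card {v : Fin (p ^ j - p ^ (j - 1)) → ZMod m // id v = v} =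
        m ^ (p ^ j - p ^ (j - 1)) := by
      refine (Nat.card_congr (Equiv.subtypeUnivEquiv fun v => (rfl : id v = v))).trans ?_
      simp
    rw [hcard] at hj'
    rw [Finset.sum_range_succ] at hj'
    have e1 : ∑ i ∈ Finset.range j, p ^ i * necklaceM p (p ^ i) =
        ∑ i ∈ Finset.range j, p ^ i * t i :=
      Finset.sum_congr rfl fun i hi => by rw [htM i (Finset.mem_range.1 hi)]
    have e2 : ∑ i ∈ Finset.range j, necklaceM p (p ^ i) = ∑ i ∈ Finset.range j, t i :=
      Finset.sum_congr rfl fun i hi => by rw [htM i (Finset.mem_range.1 hi)]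
    rw [ht, e1, e2, ← hj', Nat.add_sub_cancel_left, Nat.mul_div_cancel_left _ hn,
      Finset.sum_range_succ, add_comm]
  · rintro O ⟨v, rfl⟩
    have hv : Function.IsPeriodicPt (phiPjStep p j m) (p ^ j) v := by
      show (phiPjStep p j m)^[p ^ j] v = v
      rw [hf]; rfl
    obtain ⟨k, hk, hk'⟩ := (Nat.dvd_prime_pow hp).1 hv.minimalPeriod_dvd
    exact ⟨k, hk, by rw [aux_orbit_card _ _ hn hf, hk']⟩
end

section
/- Let p be a prime with p ≡ 2 or 3 (mod 5), and suppose the Pisano period π(p) satisfies π(p) = 2(p+1)/α for a positive odd integer α. Then every orbit of the Fibonacci state map T_p on (ℤ/pℤ)² other than the fixed point {(0,0)} has length exactly π(p), and the total number of orbits equals α(p−1)/2 + 1. -/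
/-- The Fibonacci state map `T_m(a, b) = (b, a + b)` on `(ℤ/mℤ)²`, the
state-transition map of the recurrence `a_n = a_{n-1} + a_{n-2}`. -/
def fibStep (m : ℕ) (x : ZMod m × ZMod m) : ZMod m × ZMod m := (x.2, x.1 + x.2)

/-- The Pisano period `π(m)`: the least positive `n` with `T_m^n = id`. -/
noncomputable def pisano (m : ℕ) : ℕ := sInf {n : ℕ | 0 < n ∧ (fibStep m)^[n] = id}

lemma fib_five_nonsq (p : ℕ) [Fact p.Prime] (h5 : p % 5 = 2 ∨ p % 5 = 3) (h2 : p ≠ 2) :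
    ¬ IsSquare (5 : ZMod p) := by
  have k2 : ¬ ∃ r : ZMod 5, ((2 : ℕ) : ZMod 5) = r * r := by decide
  have k3 : ¬ ∃ r : ZMod 5, ((3 : ℕ) : ZMod 5) = r * r := by decide
  haveI : Fact (Nat.Prime 5) := ⟨by norm_num⟩
  have h := ZMod.exists_sq_eq_prime_iff_of_mod_four_eq_one (p := 5) (q := p) (by norm_num) h2
  intro hs
  have h3 := h.2 (by exact_mod_cast hs)
  rw [← ZMod.natCast_mod p 5] at h3
  rcases h5 with h | h <;> rw [h] at h3
  · exact k2 h3
  · exact k3 h3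

lemma fib_form_ne (p : ℕ) (hp : p.Prime) (h5 : p % 5 = 2 ∨ p % 5 = 3) (a b : ZMod p)
    (h : a * (a + b) - b * b = 0) : a = 0 ∧ b = 0 := by
  by_cases h2 : p = 2
  · subst h2
    revert a b
    decide
  haveI : Fact p.Prime := ⟨hp⟩
  have hb : b = 0 := by
    by_contra hb
    apply fib_five_nonsq p h5 h2
    refine ⟨(2 * a + b) / b, ?_⟩
    field_simp
    linear_combination (-4) * h
  subst hb
  simpa using h

lemma fib_iter_lin (p : ℕ) (k : ℕ) (x y : ZMod p) (v w : ZMod p × ZMod p) :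
    (fibStep p)^[k] (x • v + y • w) = x • (fibStep p)^[k] v + y • (fibStep p)^[k] w := by
  induction k generalizing v w with
  | zero => rfl
  | succ k ih =>
    rw [Function.iterate_succ_apply, Function.iterate_succ_apply, Function.iterate_succ_apply,
      ← ih]
    congr 1
    ext
    · simp [fibStep]
    · simp [fibStep]; ring

lemma fib_fix (p : ℕ) (hp : p.Prime) (h5 : p % 5 = 2 ∨ p % 5 = 3) (k : ℕ)
    (v : ZMod p × ZMod p) (hv : v ≠ 0) (h : (fibStep p)^[k] v = v) :
    (fibStep p)^[k] = id := by
  haveI : Fact p.Prime := ⟨hp⟩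
  obtain ⟨a, b⟩ := v
  have hD : a * (a + b) - b * b ≠ 0 := by
    intro h0
    obtain ⟨rfl, rfl⟩ := fib_form_ne p hp h5 a b h0
    exact hv rfl
  have h' : (fibStep p)^[k] (fibStep p (a, b)) = fibStep p (a, b) := by
    rw [← Function.iterate_succ_apply, Function.iterate_succ_apply', h]
  obtain ⟨e, he⟩ : ∃ e, e * (a * (a + b) - b * b) = 1 := ⟨_, inv_mul_cancel₀ hD⟩
  funext w
  obtain ⟨c, d⟩ := w
  have hw : (c, d) = ((c * (a + b) - d * b) * e) • (a, b)
      + ((a * d - b * c) * e) • fibStep p (a, b) := by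
    ext
    · simp only [fibStep, Prod.fst_add, Prod.smul_fst, smul_eq_mul]
      linear_combination (-c) * he
    · simp only [fibStep, Prod.snd_add, Prod.smul_snd, smul_eq_mul]
      linear_combination (-d) * he
  rw [hw, fib_iter_lin, h, h']
  rfl

lemma orbitOf_ncard_s11 {β : Type*} (f : β → β) (v : β) (h : 0 < Function.minimalPeriod f v) :
    (orbitOf f v).ncard = Function.minimalPeriod f v := by
  have : orbitOf f v = (fun k => f^[k] v) '' Set.Iio (Function.minimalPeriod f v) := by
    ext w
    constructor
    · rintro ⟨k, rfl⟩
      exact ⟨k % Function.minimalPeriod f v, Nat.mod_lt _ h,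
        Function.iterate_mod_minimalPeriod_eq⟩
    · rintro ⟨k, -, rfl⟩
      exact ⟨k, rfl⟩
  rw [this, Set.ncard_image_of_injOn Function.iterate_injOn_Iio_minimalPeriod]
  simp [Set.ncard_eq_toFinset_card']

lemma orbitOf_eq_iff {β : Type*} (f : β → β) (n : ℕ) (hn : 0 < n) (hf : f^[n] = id) (v w : β) :
    orbitOf f w = orbitOf f v ↔ w ∈ orbitOf f v := by
  constructor
  · intro h
    rw [← h]
    exact ⟨0, rfl⟩
  · rintro ⟨k, rfl⟩
    ext u
    constructor
    · rintro ⟨j, rfl⟩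
      exact ⟨j + k, Function.iterate_add_apply f j k v⟩
    · rintro ⟨j, rfl⟩
      refine ⟨j + (n - 1) * k, ?_⟩
      rw [← Function.iterate_add_apply]
      have : j + (n - 1) * k + k = j + n * k := by
        obtain ⟨m, rfl⟩ : ∃ m, n = m + 1 := ⟨n - 1, by omega⟩
        simp; ring
      rw [this, Function.iterate_add_apply, Function.iterate_mul, hf]
      simp

/-- Class A primes: if `p ≡ 2, 3 (mod 5)` and
`π(p) = 2(p+1)/α` for a positive odd `α`, then every orbit of `T_p` other than
the fixed point `{(0,0)}` has length exactly `π(p)`, and the total number of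
orbits is `α(p-1)/2 + 1` (stated in the cleared-denominator form
`2·#orbits = α(p-1) + 2`). -/
theorem fib_orbit_count_classA (p α : ℕ) (hp : p.Prime)
    (h5 : p % 5 = 2 ∨ p % 5 = 3) (hα : 0 < α) (hαodd : Odd α)
    (hπ : pisano p * α = 2 * (p + 1)) :
    (∀ O ∈ orbitsOf (fibStep p),
      O ≠ {((0 : ZMod p), (0 : ZMod p))} → O.ncard = pisano p) ∧
    2 * (orbitsOf (fibStep p)).ncard = α * (p - 1) + 2 := by
  classical
  haveI : Fact p.Prime := ⟨hp⟩
  have hpos : 0 < pisano p := by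
    rcases Nat.eq_zero_or_pos (pisano p) with h | h
    · rw [h] at hπ; omega
    · exact h
  have hid : (fibStep p)^[pisano p] = id := by
    have hne : {n : ℕ | 0 < n ∧ (fibStep p)^[n] = id}.Nonempty := by
      by_contra hne
      rw [Set.not_nonempty_iff_eq_empty] at hne
      unfold pisano at hpos
      rw [hne] at hpos
      simp at hpos
    exact (Nat.sInf_mem hne).2
  have hcard : ∀ v : ZMod p × ZMod p, v ≠ 0 → (orbitOf (fibStep p) v).ncard = pisano p := by
    intro v hv
    have hper : Function.IsPeriodicPt (fibStep p) (pisano p) v := by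
      change (fibStep p)^[pisano p] v = v
      rw [hid]; rfl
    have hq := hper.minimalPeriod_pos hpos
    rw [orbitOf_ncard_s11 _ _ hq]
    refine le_antisymm (hper.minimalPeriod_le hpos) (Nat.sInf_le ⟨hq, ?_⟩)
    exact fib_fix p hp h5 _ v hv (Function.isPeriodicPt_minimalPeriod _ _)
  have hz : orbitOf (fibStep p) 0 = {((0 : ZMod p), (0 : ZMod p))} := by
    have h0 : ∀ k, (fibStep p)^[k] 0 = 0 := fun k =>
      Function.iterate_fixed (by simp [fibStep]) k
    ext w
    constructor
    · rintro ⟨k, rfl⟩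
      rw [h0]; rfl
    · rintro rfl
      exact ⟨0, rfl⟩
  have hall : ∀ O ∈ orbitsOf (fibStep p),
      O ≠ {((0 : ZMod p), (0 : ZMod p))} → O.ncard = pisano p := by
    rintro O ⟨v, rfl⟩ hO
    apply hcard
    rintro rfl
    exact hO hz
  refine ⟨hall, ?_⟩
  set S : Finset (Set (ZMod p × ZMod p)) := Finset.univ.image (orbitOf (fibStep p)) with hS
  have hSc : (orbitsOf (fibStep p)).ncard = S.card := by
    rw [← Set.ncard_coe_finset]
    congr 1
    simp [hS, orbitsOf]
  have hsum := Finset.card_eq_sum_card_fiberwise (s := (Finset.univ : Finset (ZMod p × ZMod p)))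
    (t := S) (f := orbitOf (fibStep p)) (fun v _ => by simp [hS])
  have hfib : ∀ O ∈ S, (Finset.univ.filter fun v => orbitOf (fibStep p) v = O).card
      = O.ncard := by
    intro O hO
    obtain ⟨v, -, rfl⟩ := Finset.mem_image.1 hO
    rw [← Set.ncard_coe_finset]
    congr 1
    ext w
    simp [orbitOf_eq_iff (fibStep p) _ hpos hid]
  have h0S : ({((0 : ZMod p), (0 : ZMod p))} : Set (ZMod p × ZMod p)) ∈ S := by
    rw [← hz]
    exact Finset.mem_image_of_mem _ (Finset.mem_univ _)
  rw [Finset.sum_congr rfl hfib, ← Finset.add_sum_erase _ _ h0S, Set.ncard_singleton,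
    Finset.sum_congr rfl (g := fun _ => pisano p) (fun O hO => by
      refine hall O ?_ (Finset.ne_of_mem_erase hO)
      obtain ⟨v, -, rfl⟩ := Finset.mem_image.1 (Finset.mem_of_mem_erase hO)
      exact ⟨v, rfl⟩), Finset.sum_const, smul_eq_mul, Finset.card_univ, Fintype.card_prod,
    ZMod.card] at hsum
  rw [hSc, ← Finset.card_erase_add_one h0S]
  generalize (S.erase _).card = N at hsum
  obtain ⟨q, rfl⟩ : ∃ q, p = q + 1 := ⟨p - 1, by have := hp.pos; omega⟩
  rw [Nat.add_sub_cancel]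
  generalize pisano (q + 1) = P at *
  have h1 : P * (2 * N) = P * (α * q) := by
    have : N * P = q * (q + 2) := by nlinarith
    have h2 : P * α * q = 2 * (q + 1 + 1) * q := by rw [hπ]
    nlinarith
  have := Nat.eq_of_mul_eq_mul_left hpos h1
  omega
end
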